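/- arXiv:1403.4673 — 2 statements merged into one kernel-verified Lean document; each statement's English description precedes it below -/
import Mathlib

section
/- The Nichols Hopf algebra E(n) is Galois-theoretical. Moreover, the fields L ⊇ k admitting an inner faithful E(n)-action are precisely those of the form L = F[u]/(u² − v), where F = L^{E(n)} is the invariant subfield and v ∈ F^× is a nonsquare; the action satisfies g·u = −u, x_i·u = w_i ∈ F with w₁, …, w_n linearly independent over k, and g·r₀ = r₀, x_i·r₀ = 0 for all r₀ ∈ F. In particular, L is a quadratic Galois extension of F with Galois group ℤ₂. -/
open TensorProduct

/-- A grouplike element of a Hopf algebra. -/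
def IsGrouplike (k : Type) {H : Type} [CommSemiring k] [Semiring H] [HopfAlgebra k H]
    (g : H) : Prop :=
  g ≠ 0 ∧ Coalgebra.comul (R := k) g = g ⊗ₜ[k] g

/-- A Hopf ideal of a Hopf algebra `H` over `k`: a two-sided ideal which is also a coideal
and is stable under the antipode. -/
structure HopfIdeal (k H : Type) [CommSemiring k] [Semiring H] [HopfAlgebra k H] where
  carrier : Submodule k H
  mul_mem_left : ∀ (a : H) {x : H}, x ∈ carrier → a * x ∈ carrier
  mul_mem_right : ∀ (a : H) {x : H}, x ∈ carrier → x * a ∈ carrier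
  comul_mem : ∀ x ∈ carrier, Coalgebra.comul (R := k) x ∈
      (LinearMap.range (TensorProduct.map carrier.subtype (LinearMap.id (M := H))) ⊔
       LinearMap.range (TensorProduct.map (LinearMap.id (M := H)) carrier.subtype))
  counit_eq_zero : ∀ x ∈ carrier, Coalgebra.counit (R := k) x = 0
  antipode_mem : ∀ x ∈ carrier, HopfAlgebra.antipode (R := k) x ∈ carrier

/-- A (left) action of a Hopf algebra `H` on an algebra `A`, making `A` an `H`-module algebra:
`h ⬝ (a b) = ∑ (h₁ ⬝ a) (h₂ ⬝ b)` and `h ⬝ 1 = ε(h) 1`. -/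
structure HopfAction (k H A : Type) [CommSemiring k] [Semiring H] [HopfAlgebra k H]
    [Semiring A] [Algebra k A] where
  act : H →ₐ[k] Module.End k A
  act_mul : ∀ (h : H) (a b : A),
    act h (a * b) = LinearMap.mul' k A
      (TensorProduct.map ((act.toLinearMap : H →ₗ[k] A →ₗ[k] A).flip a)
        ((act.toLinearMap : H →ₗ[k] A →ₗ[k] A).flip b) (Coalgebra.comul (R := k) h))
  act_one : ∀ h : H, act h (1 : A) = Coalgebra.counit (R := k) h • (1 : A)

/-- A module over a Hopf algebra (given by its structure map `ρ`) is inner faithful if no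
nonzero Hopf ideal annihilates it. -/
def InnerFaithful (k : Type) {H M : Type} [CommSemiring k] [Semiring H] [HopfAlgebra k H]
    [AddCommMonoid M] [Module k M] (ρ : H →ₗ[k] Module.End k M) : Prop :=
  ∀ I : HopfIdeal k H, (∀ x ∈ I.carrier, ρ x = 0) → I.carrier = ⊥

/-- A witness that the Hopf algebra `H` is Galois-theoretical: a field `L ⊇ k` together with an
inner faithful `H`-module algebra structure on `L`. -/
structure GTWitness (k H : Type) [Field k] [Semiring H] [HopfAlgebra k H] : Type 1 where
  L : Type
  [fieldL : Field L]
  [algL : Algebra k L]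
  action : HopfAction k H L
  faithful : InnerFaithful k action.act.toLinearMap

/-- A Hopf algebra is Galois-theoretical if it acts inner faithfully and `k`-linearly on a field
containing `k`. -/
def GaloisTheoretical (k H : Type) [Field k] [Semiring H] [HopfAlgebra k H] : Prop :=
  Nonempty (GTWitness k H)

/-- The set of invariants of a Hopf algebra action. -/
def HopfAction.invariants {k H A : Type} [CommSemiring k] [Semiring H] [HopfAlgebra k H]
    [Semiring A] [Algebra k A] (ha : HopfAction k H A) : Set A :=
  {a : A | ∀ h : H, ha.act h a = Coalgebra.counit (R := k) h • a}

/-- A subcoalgebra: a subspace `V` with `Δ(V) ⊆ V ⊗ V`. -/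
def IsSubcoalgebra (k : Type) {H : Type} [CommSemiring k] [Semiring H] [HopfAlgebra k H]
    (V : Submodule k H) : Prop :=
  ∀ x ∈ V, Coalgebra.comul (R := k) x ∈ LinearMap.range (TensorProduct.map V.subtype V.subtype)

/-- A simple subcoalgebra: a nonzero subcoalgebra with no nonzero proper subcoalgebras. -/
def IsSimpleSubcoalgebra (k : Type) {H : Type} [CommSemiring k] [Semiring H] [HopfAlgebra k H]
    (V : Submodule k H) : Prop :=
  IsSubcoalgebra k V ∧ V ≠ ⊥ ∧
    ∀ W : Submodule k H, IsSubcoalgebra k W → W ≤ V → W = ⊥ ∨ W = V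

/-- The coradical of a Hopf algebra: the sum of all its simple subcoalgebras. -/
def coradical (k H : Type) [CommSemiring k] [Semiring H] [HopfAlgebra k H] : Submodule k H :=
  sSup {V : Submodule k H | IsSimpleSubcoalgebra k V}

/-- A Hopf algebra is pointed iff its coradical is spanned by the grouplike elements. -/
def IsPointedHopf (k H : Type) [CommSemiring k] [Semiring H] [HopfAlgebra k H] : Prop :=
  coradical k H = Submodule.span k {g : H | IsGrouplike k g}

/-- A witness that a field `F ⊇ k` with a nonsquare `v ∈ F^×` gives rise to an inner faithful
module field `L = F[u]/(u² - v)` for the Nichols Hopf algebra `E(n)` (with generators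
`g`, `x i`). -/
structure NicholsExtensionWitness (k T : Type) [Field k] [Ring T] [HopfAlgebra k T]
    (n : ℕ) (g : T) (x : Fin n → T) (F : Type) [Field F] [Algebra k F] (v : F) : Type 1 where
  L : Type
  [fieldL : Field L]
  [algL : Algebra k L]
  emb : F →ₐ[k] L
  action : HopfAction k T L
  faithful : InnerFaithful k action.act.toLinearMap
  u : L
  u_sq : u ^ 2 = emb v
  act_g_u : action.act g u = -u
  w : Fin n → F
  act_x_u : ∀ i : Fin n, action.act (x i) u = emb (w i)
  w_indep : LinearIndependent k w
  inv_eq : Set.range ⇑emb = action.invariants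
  gen : Algebra.adjoin k (Set.range ⇑emb ∪ {u}) = ⊤


namespace NicholsAux

theorem sq_zero {k A : Type} [Field k] [CharZero k] [Ring A] [Algebra k A] {n : ℕ}
    (X : Fin n → A) (hX : ∀ i j, X i * X j = -(X j * X i)) (d : Fin n → k) :
    (∑ i, d i • X i) * (∑ i, d i • X i) = 0 := by
  have h1 : (∑ i, d i • X i) * (∑ i, d i • X i) = ∑ i, ∑ j, (d i * d j) • (X i * X j) := by
    simp only [Finset.sum_mul_sum, smul_mul_smul_comm]
  have h2 : ∑ i, ∑ j, (d i * d j) • (X i * X j) = - ∑ i, ∑ j, (d i * d j) • (X i * X j) := by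
    conv_lhs => rw [Finset.sum_comm]
    simp only [← Finset.sum_neg_distrib]
    refine Finset.sum_congr rfl fun i _ => Finset.sum_congr rfl fun j _ => ?_
    rw [hX j i, mul_comm (d j), smul_neg]
  rw [h1]
  have h3 : (2 : k) • (∑ i, ∑ j, (d i * d j) • (X i * X j)) = 0 := by
    rw [two_smul]; nth_rewrite 1 [h2]; simp
  exact (smul_eq_zero.1 h3).resolve_left two_ne_zero

noncomputable def Q (k : Type) [Field k] (n : ℕ) : QuadraticForm k (k × (Fin n → k)) :=
  (QuadraticMap.sq (R := k)).comp (LinearMap.fst k k (Fin n → k))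

noncomputable def lin {k A : Type} [Field k] [Ring A] [Algebra k A] {n : ℕ}
    (G : A) (X : Fin n → A) : (k × (Fin n → k)) →ₗ[k] A :=
  (LinearMap.toSpanSingleton k A G).coprod (Fintype.linearCombination k X)

theorem lin_apply {k A : Type} [Field k] [Ring A] [Algebra k A] {n : ℕ}
    (G : A) (X : Fin n → A) (p) : lin (k := k) G X p = p.1 • G + ∑ i, p.2 i • X i := by
  simp [lin, Fintype.linearCombination_apply]

theorem lin_sq {k A : Type} [Field k] [CharZero k] [Ring A] [Algebra k A] {n : ℕ}
    (G : A) (X : Fin n → A) (hG : G * G = 1) (hGX : ∀ i, G * X i = -(X i * G))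
    (hX : ∀ i j, X i * X j = -(X j * X i)) (p) :
    lin (k := k) G X p * lin G X p = algebraMap k A (Q k n p) := by
  rw [lin_apply, add_mul, mul_add, mul_add, sq_zero X hX, smul_mul_smul_comm, hG]
  have : p.1 • G * ∑ i, p.2 i • X i = - ((∑ i, p.2 i • X i) * p.1 • G) := by
    rw [Finset.mul_sum, Finset.sum_mul, ← Finset.sum_neg_distrib]
    refine Finset.sum_congr rfl fun i _ => ?_
    rw [smul_mul_smul_comm, smul_mul_smul_comm, hGX, smul_neg, mul_comm]
  rw [this, Algebra.algebraMap_eq_smul_one]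
  simp [Q]

noncomputable def cl {k A : Type} [Field k] [CharZero k] [Ring A] [Algebra k A] {n : ℕ}
    (G : A) (X : Fin n → A) (hG : G * G = 1) (hGX : ∀ i, G * X i = -(X i * G))
    (hX : ∀ i j, X i * X j = -(X j * X i)) : CliffordAlgebra (Q k n) →ₐ[k] A :=
  CliffordAlgebra.lift (Q k n) ⟨lin G X, lin_sq G X hG hGX hX⟩

theorem finrank_cl (k : Type) [Field k] [CharZero k] (n : ℕ) :
    Module.Finite k (CliffordAlgebra (Q k n)) ∧
    Module.finrank k (CliffordAlgebra (Q k n)) = 2 ^ (n + 1) := by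
  have : Invertible (2 : k) := invertibleOfNonzero two_ne_zero
  let b := (Module.finBasis k (k × (Fin n → k))).ExteriorAlgebra.map
    (CliffordAlgebra.equivExterior (Q k n)).symm
  refine ⟨Module.Finite.of_basis b, ?_⟩
  rw [Module.finrank_eq_card_basis b]
  simp [add_comm]

theorem exists_lift {k : Type} [Field k] [CharZero k] {n : ℕ}
    {T : Type} [Ring T] [Algebra k T] (g : T) (x : Fin n → T)
    (hg2 : g ^ 2 = 1)
    (hgx : ∀ i : Fin n, g * x i = -(x i * g))
    (hxx : ∀ i j : Fin n, x i * x j = -(x j * x i))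
    (hgen : Algebra.adjoin k ({g} ∪ Set.range x) = ⊤)
    (hdim : Module.finrank k T = 2 ^ (n + 1))
    {A : Type} [Ring A] [Algebra k A]
    (G : A) (X : Fin n → A) (hG : G * G = 1) (hGX : ∀ i, G * X i = -(X i * G))
    (hX : ∀ i j, X i * X j = -(X j * X i)) :
    ∃ f : T →ₐ[k] A, f g = G ∧ ∀ i, f (x i) = X i := by
  have hf := finrank_cl k n
  have := hf.1
  let π : CliffordAlgebra (Q k n) →ₐ[k] T := cl g x (by rw [← hg2, sq]) hgx hxx
  have hπ : ∀ p, π (CliffordAlgebra.ι _ p) = lin g x p := fun p => by simp [π, cl]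
  have hlg : ∀ (B : Type) [Ring B] [Algebra k B] (G : B) (X : Fin n → B),
      lin (k := k) G X (1, 0) = G := fun B _ _ G X => by simp [lin_apply]
  have hlx : ∀ (B : Type) [Ring B] [Algebra k B] (G : B) (X : Fin n → B) i,
      lin (k := k) G X (0, Pi.single i 1) = X i := fun B _ _ G X i => by
    simp [lin_apply, Pi.single_apply, ite_smul]
  have hsurj : Function.Surjective π := by
    rw [← AlgHom.range_eq_top, eq_top_iff, ← hgen, Algebra.adjoin_le_iff]
    rintro _ (rfl | ⟨i, rfl⟩)
    · exact ⟨CliffordAlgebra.ι _ (1, 0), (hπ _).trans (hlg ..)⟩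
    · exact ⟨CliffordAlgebra.ι _ (0, Pi.single i 1), (hπ _).trans (hlx ..)⟩
  have : Module.Finite k T := Module.Finite.of_surjective π.toLinearMap hsurj
  have hinj : Function.Injective π :=
    (LinearMap.injective_iff_surjective_of_finrank_eq_finrank (f := π.toLinearMap)
      (hf.2.trans hdim.symm)).2 hsurj
  let e := AlgEquiv.ofBijective π ⟨hinj, hsurj⟩
  refine ⟨(cl G X hG hGX hX).comp e.symm.toAlgHom, ?_, fun i => ?_⟩
  · have : e.symm g = CliffordAlgebra.ι _ (1, 0) := by
      rw [AlgEquiv.symm_apply_eq]; exact ((hπ _).trans (hlg ..)).symm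
    simp [this, cl, hlg]
  · have : e.symm (x i) = CliffordAlgebra.ι _ (0, Pi.single i 1) := by
      rw [AlgEquiv.symm_apply_eq]; exact ((hπ _).trans (hlx ..)).symm
    simp [this, cl, hlx]

section hopf
variable {k T : Type} [Field k] [Ring T] [HopfAlgebra k T]

theorem counit_g {g : T} (hg : IsGrouplike k g) : Coalgebra.counit (R := k) g = 1 := by
  have h := Coalgebra.rTensor_counit_comul (R := k) g
  rw [hg.2, LinearMap.rTensor_tmul] at h
  have h2 := congrArg (TensorProduct.lid k T) h
  simp only [TensorProduct.lid_tmul, one_smul] at h2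
  have h3 : (Coalgebra.counit (R := k) g - 1) • g = 0 := by rw [sub_smul, h2, one_smul, sub_self]
  exact sub_eq_zero.1 ((smul_eq_zero.1 h3).resolve_right hg.1)

theorem counit_s {g s : T} (hg : IsGrouplike k g)
    (hs : Coalgebra.comul (R := k) s = g ⊗ₜ[k] s + s ⊗ₜ[k] (1 : T)) :
    Coalgebra.counit (R := k) s = 0 := by
  have : Nontrivial T := ⟨g, 0, hg.1⟩
  have h := Coalgebra.rTensor_counit_comul (R := k) s
  rw [hs, map_add, LinearMap.rTensor_tmul, LinearMap.rTensor_tmul, counit_g hg] at h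
  have h2 := congrArg (TensorProduct.lid k T) h
  simp only [TensorProduct.lid_tmul, one_smul, map_add, add_eq_left] at h2
  exact (smul_eq_zero.1 h2).resolve_right one_ne_zero

theorem antipode_s {g s : T} (hg : IsGrouplike k g)
    (hs : Coalgebra.comul (R := k) s = g ⊗ₜ[k] s + s ⊗ₜ[k] (1 : T)) :
    HopfAlgebra.antipode k s = -(HopfAlgebra.antipode k g * s) := by
  have h := HopfAlgebra.mul_antipode_rTensor_comul_apply (R := k) s
  rw [hs, counit_s hg hs] at h
  simp only [map_add, LinearMap.rTensor_tmul, LinearMap.mul'_apply, mul_one, map_zero] at h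
  exact eq_neg_of_add_eq_zero_right h

def sIdeal {g s : T} (hg : IsGrouplike k g)
    (hs : Coalgebra.comul (R := k) s = g ⊗ₜ[k] s + s ⊗ₜ[k] (1 : T)) : HopfIdeal k T where
  carrier := Submodule.span k {t | ∃ a b, t = a * s * b}
  mul_mem_left := fun a x hx => by
    induction hx using Submodule.span_induction with
    | mem x h =>
      obtain ⟨c, d, rfl⟩ := h
      exact Submodule.subset_span ⟨a * c, d, by simp only [mul_assoc]⟩
    | zero => simp
    | add x y _ _ hx hy => rw [mul_add]; exact add_mem hx hy
    | smul r x _ hx => rw [mul_smul_comm]; exact Submodule.smul_mem _ _ hx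
  mul_mem_right := fun a x hx => by
    induction hx using Submodule.span_induction with
    | mem x h =>
      obtain ⟨c, d, rfl⟩ := h
      exact Submodule.subset_span ⟨c, d * a, by simp only [mul_assoc]⟩
    | zero => simp
    | add x y _ _ hx hy => rw [add_mul]; exact add_mem hx hy
    | smul r x _ hx => rw [smul_mul_assoc]; exact Submodule.smul_mem _ _ hx
  comul_mem := fun x hx => by
    induction hx using Submodule.span_induction with
    | mem x h =>
      obtain ⟨c, d, rfl⟩ := h
      rw [Bialgebra.comul_mul, Bialgebra.comul_mul, hs]
      generalize Coalgebra.comul (R := k) c = C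
      generalize Coalgebra.comul (R := k) d = D
      induction C with
      | zero => simp
      | add x y hx hy => rw [add_mul, add_mul]; exact add_mem hx hy
      | tmul c₁ c₂ =>
        induction D with
        | zero => simp
        | add x y hx hy => rw [mul_add]; exact add_mem hx hy
        | tmul d₁ d₂ =>
          rw [mul_add, add_mul]
          simp only [Algebra.TensorProduct.tmul_mul_tmul]
          refine add_mem (Submodule.mem_sup_right ?_) (Submodule.mem_sup_left ?_)
          · exact ⟨(c₁ * g * d₁) ⊗ₜ ⟨c₂ * s * d₂, Submodule.subset_span ⟨_, _, rfl⟩⟩, by simp⟩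
          · exact ⟨⟨c₁ * s * d₁, Submodule.subset_span ⟨_, _, rfl⟩⟩ ⊗ₜ (c₂ * 1 * d₂), by simp⟩
    | zero => simp
    | add x y _ _ hx hy => rw [map_add]; exact add_mem hx hy
    | smul r x _ hx => rw [map_smul]; exact Submodule.smul_mem _ _ hx
  counit_eq_zero := fun x hx => by
    induction hx using Submodule.span_induction with
    | mem x h =>
      obtain ⟨c, d, rfl⟩ := h
      simp [Bialgebra.counit_mul, counit_s hg hs]
    | zero => simp
    | add x y _ _ hx hy => rw [map_add, hx, hy, add_zero]
    | smul r x _ hx => rw [map_smul, hx, smul_zero]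
  antipode_mem := fun x hx => by
    induction hx using Submodule.span_induction with
    | mem x h =>
      obtain ⟨c, d, rfl⟩ := h
      rw [HopfAlgebra.antipode_mul_antidistrib, HopfAlgebra.antipode_mul_antidistrib,
        antipode_s hg hs]
      refine Submodule.subset_span ⟨-(HopfAlgebra.antipode k d * HopfAlgebra.antipode k g),
        HopfAlgebra.antipode k c, by simp only [mul_assoc, neg_mul, mul_neg]⟩
    | zero => simp
    | add x y _ _ hx hy => rw [map_add]; exact add_mem hx hy
    | smul r x _ hx => rw [map_smul]; exact Submodule.smul_mem _ _ hx

theorem eq_zero_of_act {L : Type} [Semiring L] [Algebra k L] {g s : T} (hg : IsGrouplike k g)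
    (hs : Coalgebra.comul (R := k) s = g ⊗ₜ[k] s + s ⊗ₜ[k] (1 : T))
    (ha : HopfAction k T L) (hf : InnerFaithful k ha.act.toLinearMap) (h0 : ha.act s = 0) :
    s = 0 := by
  have h := hf (sIdeal hg hs) (fun x hx => by
    have hx2 : x ∈ Submodule.span k {t | ∃ a b, t = a * s * b} := hx
    clear hx
    induction hx2 using Submodule.span_induction with
    | mem x h =>
      obtain ⟨c, d, rfl⟩ := h
      simp [h0]
    | zero => simp
    | add x y h1 h2 hx hy => rw [map_add, hx, hy, add_zero]
    | smul r x h1 hx => rw [map_smul, hx, smul_zero])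
  have hm : s ∈ (sIdeal hg hs).carrier := Submodule.subset_span ⟨1, 1, by simp⟩
  rw [h] at hm
  simpa using hm

/-- Hopf action from conditions on generators. -/
def mkAction {n : ℕ} {g : T} {x : Fin n → T} (hg : IsGrouplike k g)
    (hx : ∀ i : Fin n, Coalgebra.comul (R := k) (x i) = g ⊗ₜ[k] (x i) + (x i) ⊗ₜ[k] (1 : T))
    (hgen : Algebra.adjoin k ({g} ∪ Set.range x) = ⊤)
    {L : Type} [Semiring L] [Algebra k L] (f : T →ₐ[k] Module.End k L)
    (hgm : ∀ a b, f g (a * b) = f g a * f g b)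
    (hxm : ∀ i a b, f (x i) (a * b) = f g a * f (x i) b + f (x i) a * b)
    (hg1 : f g 1 = 1) (hx1 : ∀ i, f (x i) 1 = 0) : HopfAction k T L where
  act := f
  act_mul := by
    let ρ : T ⊗[k] T →ₐ[k] Module.End k (L ⊗[k] L) :=
      (Module.endTensorEndAlgHom (R := k) (S := k) (A := k) (M := L) (N := L)).comp
        (Algebra.TensorProduct.map f f)
    have hρt : ∀ (c d : T) (a b : L), ρ (c ⊗ₜ d) (a ⊗ₜ b) = f c a ⊗ₜ f d b :=
      fun c d a b => rfl
    have hρ : ∀ (t : T ⊗[k] T) (a b : L), TensorProduct.map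
        ((f.toLinearMap : T →ₗ[k] L →ₗ[k] L).flip a)
        ((f.toLinearMap : T →ₗ[k] L →ₗ[k] L).flip b) t = ρ t (a ⊗ₜ b) := by
      intro t a b
      induction t with
      | zero => simp
      | add x y hx hy => simp only [map_add, hx, hy, LinearMap.add_apply]
      | tmul c d => simp [hρt]
    have key : ∀ h : T, (f h) ∘ₗ LinearMap.mul' k L =
        LinearMap.mul' k L ∘ₗ ρ (Coalgebra.comul (R := k) h) := by
      intro h
      have hh : h ∈ Algebra.adjoin k ({g} ∪ Set.range x) := hgen ▸ Algebra.mem_top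
      induction hh using Algebra.adjoin_induction with
      | mem y hy =>
        rcases hy with rfl | ⟨i, rfl⟩
        · ext a b; simp [hg.2, hρt, hgm]
        · ext a b; simp [hx, hρt, hxm]
      | algebraMap r =>
        ext a b; simp [Algebra.algebraMap_eq_smul_one, ρ]
      | add a b _ _ ha hb => simp only [map_add, LinearMap.add_comp, LinearMap.comp_add, ha, hb]
      | mul a b _ _ ha hb =>
        rw [Bialgebra.comul_mul, map_mul, map_mul, Module.End.mul_eq_comp, Module.End.mul_eq_comp,
          LinearMap.comp_assoc, hb, ← LinearMap.comp_assoc, ha, LinearMap.comp_assoc]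
    intro h a b
    rw [hρ]
    simpa using LinearMap.congr_fun (key h) (a ⊗ₜ b)
  act_one := by
    intro h
    have hh : h ∈ Algebra.adjoin k ({g} ∪ Set.range x) := hgen ▸ Algebra.mem_top
    induction hh using Algebra.adjoin_induction with
    | mem y hy =>
      rcases hy with rfl | ⟨i, rfl⟩
      · simp [hg1, counit_g hg]
      · simp [hx1, counit_s hg (hx i)]
    | algebraMap r => simp
    | add a b _ _ ha hb => simp only [map_add, LinearMap.add_apply, ha, hb, add_smul]
    | mul a b _ _ ha hb =>
      simp only [map_mul, Module.End.mul_apply, ha, hb, Bialgebra.counit_mul, map_smul, mul_smul]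
      rw [smul_comm]

end hopf

section faithful
variable {k T : Type} [Field k] [Ring T] [HopfAlgebra k T]

noncomputable def E (ξ : T →ₗ[k] k) : T ⊗[k] T →ₗ[k] T :=
  (TensorProduct.rid k T).toLinearMap ∘ₗ LinearMap.lTensor T ξ

theorem E_tmul (ξ : T →ₗ[k] k) (a b : T) : E ξ (a ⊗ₜ b) = ξ b • a := by
  simp [E]

theorem E_counit (a : T) : E (Coalgebra.counit (R := k)) (Coalgebra.comul (R := k) a) = a := by
  simp [E]

theorem E_mul (ξ χ ζ : T →ₗ[k] k) (h : ∀ a b, ξ (a * b) = ξ a * χ b + ζ a * ξ b)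
    (s t : T ⊗[k] T) : E ξ (s * t) = E ξ s * E χ t + E ζ s * E ξ t := by
  induction s with
  | zero => simp
  | add x y hx hy => rw [add_mul, map_add, hx, hy, map_add, map_add, add_mul, add_mul]; abel
  | tmul a b =>
    induction t with
    | zero => simp
    | add x y hx hy => rw [mul_add, map_add, hx, hy, map_add, map_add, mul_add, mul_add]; abel
    | tmul c d =>
      simp only [Algebra.TensorProduct.tmul_mul_tmul, E_tmul, h, smul_mul_smul_comm, add_smul]

theorem E_mul' (χ : T →ₗ[k] k) (h : ∀ a b, χ (a * b) = χ a * χ b)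
    (s t : T ⊗[k] T) : E χ (s * t) = E χ s * E χ t := by
  have := E_mul χ χ 0 (by simp [h]) s t
  simpa [E] using this

theorem E_ideal (ξ : T →ₗ[k] k) (I : HopfIdeal k T) (hI : ∀ a ∈ I.carrier, ξ a = 0) (a : T)
    (ha : a ∈ I.carrier) : E ξ (Coalgebra.comul (R := k) a) ∈ I.carrier := by
  have h := I.comul_mem a ha
  have hle : (LinearMap.range (TensorProduct.map I.carrier.subtype (LinearMap.id (M := T))) ⊔
       LinearMap.range (TensorProduct.map (LinearMap.id (M := T)) I.carrier.subtype)) ≤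
       I.carrier.comap (E ξ) := by
    refine sup_le ?_ ?_
    · rintro _ ⟨t, rfl⟩
      induction t with
      | zero => simp
      | add x y hx hy => rw [map_add]; exact add_mem hx hy
      | tmul c d =>
        rw [Submodule.mem_comap, TensorProduct.map_tmul, E_tmul]
        exact Submodule.smul_mem _ _ c.2
    · rintro _ ⟨t, rfl⟩
      induction t with
      | zero => simp
      | add x y hx hy => rw [map_add]; exact add_mem hx hy
      | tmul c d =>
        rw [Submodule.mem_comap, TensorProduct.map_tmul, E_tmul, Submodule.subtype_apply,
          hI _ d.2, zero_smul]
        exact zero_mem _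
  exact hle h

theorem exists_DQ {n : ℕ} {g : T} {x : Fin n → T} (hg : IsGrouplike k g)
    (hx : ∀ i : Fin n, Coalgebra.comul (R := k) (x i) = g ⊗ₜ[k] (x i) + (x i) ⊗ₜ[k] (1 : T))
    (hg2 : g ^ 2 = 1) (hx2 : ∀ i : Fin n, x i * x i = 0)
    (hgx : ∀ i : Fin n, g * x i = -(x i * g))
    (hxx : ∀ i j : Fin n, x i * x j = -(x j * x i))
    (hgen : Algebra.adjoin k ({g} ∪ Set.range x) = ⊤)
    (j : Fin n) (ξ χ : T →ₗ[k] k) (hχ : ∀ a b, χ (a * b) = χ a * χ b)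
    (hξ : ∀ a b, ξ (a * b) = ξ a * χ b + Coalgebra.counit (R := k) a * ξ b)
    (hχ1 : χ 1 = 1) (hχg : χ g = -1) (hχx : ∀ i, χ (x i) = 0)
    (hξ1 : ξ 1 = 0) (hξg : ξ g = 0) (hξj : ξ (x j) = 1) (hξi : ∀ i, i ≠ j → ξ (x i) = 0) :
    ∃ Q : T →ₐ[k] T, (∀ h, h = Q h + E ξ (Coalgebra.comul (R := k) h) * (g * x j)) ∧
      Q g = g ∧ Q (x j) = 0 ∧ ∀ i, i ≠ j → Q (x i) = x i := by
  have hgg : g * g = 1 := by rw [← sq, hg2]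
  have D1 : E ξ (Coalgebra.comul (R := k) (1 : T)) = 0 := by
    rw [Bialgebra.comul_one, Algebra.TensorProduct.one_def, E_tmul, hξ1, zero_smul]
  have Dg : E ξ (Coalgebra.comul (R := k) g) = 0 := by
    rw [hg.2, E_tmul, hξg, zero_smul]
  have Dj : E ξ (Coalgebra.comul (R := k) (x j)) = g := by
    rw [hx, map_add, E_tmul, E_tmul, hξj, hξ1, zero_smul, one_smul, add_zero]
  have Di : ∀ i, i ≠ j → E ξ (Coalgebra.comul (R := k) (x i)) = 0 := fun i hi => by
    rw [hx, map_add, E_tmul, E_tmul, hξi i hi, hξ1, zero_smul, zero_smul, add_zero]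
  have Dmul : ∀ a b, E ξ (Coalgebra.comul (R := k) (a * b)) =
      E ξ (Coalgebra.comul (R := k) a) * E χ (Coalgebra.comul (R := k) b) +
      a * E ξ (Coalgebra.comul (R := k) b) := fun a b => by
    rw [Bialgebra.comul_mul, E_mul ξ χ _ hξ, E_counit]
  have comm : ∀ b, g * x j * b = E χ (Coalgebra.comul (R := k) b) * (g * x j) := by
    intro b
    have hh : b ∈ Algebra.adjoin k ({g} ∪ Set.range x) := hgen ▸ Algebra.mem_top
    induction hh using Algebra.adjoin_induction with
    | mem y hy =>
      rcases hy with rfl | ⟨i, rfl⟩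
      · rw [hg.2, E_tmul, hχg, neg_one_smul, mul_assoc, neg_mul]
        rw [eq_neg_iff_add_eq_zero, ← mul_add, hgx]; simp
      · rw [hx, map_add, E_tmul, E_tmul, hχx, hχ1, zero_smul, one_smul, zero_add, mul_assoc,
          hxx, ← mul_assoc, mul_neg, ← mul_assoc, hgx, neg_mul, neg_neg]
    | algebraMap r =>
      rw [Bialgebra.comul_algebraMap, Algebra.algebraMap_eq_smul_one, Algebra.algebraMap_eq_smul_one,
        map_smul,
        Algebra.TensorProduct.one_def, E_tmul, hχ1]
      simp
    | add a b _ _ ha hb => rw [mul_add, ha, hb, map_add, map_add, add_mul]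
    | mul a b _ _ ha hb =>
      rw [Bialgebra.comul_mul, E_mul' χ hχ, ← mul_assoc, ha, mul_assoc, hb, mul_assoc]
  have yy : (g * x j) * (g * x j) = 0 := by
    rw [hgx, neg_mul_neg, mul_assoc, ← mul_assoc g, hgx]
    simp [← mul_assoc, hx2]
  refine ⟨AlgHom.ofLinearMap (LinearMap.id -
    (LinearMap.mulRight k (g * x j)) ∘ₗ E ξ ∘ₗ Coalgebra.comul) ?_ ?_, ?_, ?_, ?_, ?_⟩
  · simp only [LinearMap.sub_apply, LinearMap.id_apply, LinearMap.comp_apply, D1, map_zero, sub_zero]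
  · intro a b
    simp only [LinearMap.sub_apply, LinearMap.id_apply, LinearMap.comp_apply,
      LinearMap.mulRight_apply, Dmul]
    generalize hA : E ξ (Coalgebra.comul (R := k) a) = A
    generalize hB : E ξ (Coalgebra.comul (R := k) b) = B
    have e1 : A * (g * x j) * (B * (g * x j)) = 0 := by
      rw [mul_assoc, ← mul_assoc (g * x j), comm, mul_assoc, yy]; simp
    have e2 : A * (g * x j) * b = A * E χ (Coalgebra.comul (R := k) b) * (g * x j) := by
      rw [mul_assoc, comm, mul_assoc]
    rw [sub_mul, mul_sub, mul_sub, e1, e2, add_mul, mul_assoc a B]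
    abel
  · intro h; simp [mul_assoc]
  · simp [Dg]
  · simp [Dj, hgg]
  · intro i hi; simp [Di i hi]

theorem faithful_of [CharZero k] {n : ℕ} {g : T} {x : Fin n → T} (hg : IsGrouplike k g)
    (hx : ∀ i : Fin n, Coalgebra.comul (R := k) (x i) = g ⊗ₜ[k] (x i) + (x i) ⊗ₜ[k] (1 : T))
    (hg2 : g ^ 2 = 1) (hx2 : ∀ i : Fin n, x i * x i = 0)
    (hgx : ∀ i : Fin n, g * x i = -(x i * g))
    (hxx : ∀ i j : Fin n, x i * x j = -(x j * x i))
    (hgen : Algebra.adjoin k ({g} ∪ Set.range x) = ⊤)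
    {L : Type} [Field L] [Algebra k L] (ha : HopfAction k T L)
    (u : L) (w : Fin n → L) (hu : u ≠ 0) (hw : LinearIndependent k w)
    (hgu : ha.act g u = -u) (hxu : ∀ i, ha.act (x i) u = w i)
    (hgw : ∀ i, ha.act g (w i) = w i) (hxw : ∀ i j, ha.act (x i) (w j) = 0) :
    InnerFaithful k ha.act.toLinearMap := by
  have hcg := counit_g hg
  have hcx := fun i => counit_s hg (hx i)
  -- linear independence
  have hli : LinearIndependent k (fun o : Option (Fin n) => o.elim u w) := by
    rw [linearIndependent_option]
    refine ⟨hw, fun hmem => hu ?_⟩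
    have h1 : ha.act g u = u := by
      have : ∀ y ∈ Submodule.span k (Set.range w), ha.act g y = y := by
        intro y hy
        induction hy using Submodule.span_induction with
        | mem y hy => obtain ⟨i, rfl⟩ := hy; exact hgw i
        | zero => simp
        | add a b _ _ h1 h2 => rw [map_add, h1, h2]
        | smul r a _ h => rw [map_smul, h]
      exact this _ hmem
    have : CharZero L := charZero_of_injective_algebraMap (algebraMap k L).injective
    rw [hgu] at h1
    exact self_eq_neg.1 h1.symm
  obtain ⟨P, hP⟩ := LinearMap.exists_leftInverse_of_injective
    (Finsupp.linearCombination k (fun o : Option (Fin n) => o.elim u w))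
    (LinearMap.ker_eq_bot.2 hli)
  have hP2 : ∀ o : Option (Fin n), P (o.elim u w) = Finsupp.single o 1 := fun o => by
    simpa using LinearMap.congr_fun hP (Finsupp.single o 1)
  have hPu : P u = Finsupp.single none 1 := hP2 none
  have hPw : ∀ i, P (w i) = Finsupp.single (some i) 1 := fun i => hP2 (some i)
  have hW : ∀ h i, ha.act h (w i) = Coalgebra.counit (R := k) h • w i := by
    intro h
    have hh : h ∈ Algebra.adjoin k ({g} ∪ Set.range x) := hgen ▸ Algebra.mem_top
    induction hh using Algebra.adjoin_induction with
    | mem y hy =>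
      rcases hy with rfl | ⟨i, rfl⟩
      · simp [hgw, hcg]
      · simp [hxw, hcx]
    | algebraMap r => intro i; simp
    | add a b _ _ h1 h2 => intro i; simp [h1, h2, add_smul]
    | mul a b _ _ h1 h2 => intro i; simp only [map_mul, Module.End.mul_apply, h1, h2, map_smul,
        Bialgebra.counit_mul, mul_smul]; exact smul_comm _ _ _
  have hV : ∀ h, ∃ (c : k) (d : Fin n → k), ha.act h u = c • u + ∑ i, d i • w i := by
    intro h
    have hh : h ∈ Algebra.adjoin k ({g} ∪ Set.range x) := hgen ▸ Algebra.mem_top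
    induction hh using Algebra.adjoin_induction with
    | mem y hy =>
      rcases hy with rfl | ⟨i, rfl⟩
      · exact ⟨-1, 0, by simp [hgu]⟩
      · exact ⟨0, Pi.single i 1, by simp [hxu, Pi.single_apply, ite_smul]⟩
    | algebraMap r => exact ⟨r, 0, by simp⟩
    | add a b _ _ h1 h2 =>
      obtain ⟨c, d, h1⟩ := h1
      obtain ⟨c', d', h2⟩ := h2
      refine ⟨c + c', d + d', ?_⟩
      simp only [map_add, LinearMap.add_apply, h1, h2, add_smul, Pi.add_apply,
        Finset.sum_add_distrib]
      abel
    | mul a b _ _ h1 h2 =>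
      obtain ⟨c, d, h1⟩ := h1
      obtain ⟨c', d', h2⟩ := h2
      refine ⟨c' * c, fun i => c' * d i + d' i * Coalgebra.counit (R := k) a, ?_⟩
      simp only [map_mul, Module.End.mul_apply, h1, h2, map_add, map_smul, map_sum, hW, add_smul,
        mul_smul, smul_add, Finset.smul_sum, Finset.sum_add_distrib]
      abel
  let F : Option (Fin n) → T →ₗ[k] k := fun o =>
    Finsupp.lapply o ∘ₗ P ∘ₗ (ha.act.toLinearMap : T →ₗ[k] L →ₗ[k] L).flip u
  have hF : ∀ o h, F o h = P (ha.act h u) o := fun o h => rfl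
  have hFmul : ∀ o a b, F o (a * b) = F o a * F none b +
      Coalgebra.counit (R := k) a * (F o b - F none b * P u o) := by
    intro o a b
    obtain ⟨c, d, h⟩ := hV b
    have hc : F none b = c := by simp [hF, h, hPu, hPw]
    rw [hc]
    simp only [hF, map_mul, Module.End.mul_apply, h, map_add, map_smul, map_sum, hW,
      Finsupp.add_apply, Finsupp.smul_apply, Finsupp.finsetSum_apply, smul_eq_mul,
      smul_comm _ (Coalgebra.counit (R := k) a), ← Finset.mul_sum]
    ring
  have hQ : ∀ j, ∃ Q : T →ₐ[k] T,
      (∀ h, h = Q h + E (F (some j)) (Coalgebra.comul (R := k) h) * (g * x j)) ∧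
      Q g = g ∧ Q (x j) = 0 ∧ ∀ i, i ≠ j → Q (x i) = x i := by
    intro j
    refine exists_DQ hg hx hg2 hx2 hgx hxx hgen j (F (some j)) (F none) ?_ ?_ ?_ ?_ ?_ ?_ ?_ ?_ ?_
    · intro a b; rw [hFmul, hPu]; simp
    · intro a b; rw [hFmul, hPu]; simp
    · simp [hF, hPu]
    · simp [hF, hPu, hgu]
    · intro i; simp [hF, hPw, hxu]
    · simp [hF, hPu]
    · simp [hF, hPu, hgu]
    · simp [hF, hPw, hxu]
    · intro i hi; simp [hF, hPw, hxu, hi]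
  choose Q hQ1 hQg hQx hQi using hQ
  intro I hI
  have hD : ∀ j, ∀ h ∈ I.carrier, E (F (some j)) (Coalgebra.comul (R := k) h) ∈ I.carrier :=
    fun j h hh => E_ideal _ I (fun a haI => by
      have : ha.act a = 0 := hI a haI
      simp [hF, this]) h hh
  have hQI : ∀ j, ∀ h ∈ I.carrier, Q j h ∈ I.carrier := fun j h hh => by
    have := hQ1 j h
    rw [← sub_eq_iff_eq_add] at this
    rw [← this]
    exact sub_mem hh (I.mul_mem_right _ (hD j h hh))
  have hgg : g * g = 1 := by rw [← sq, hg2]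
  have yy : ∀ j, (g * x j) * (g * x j) = 0 := fun j => by
    rw [hgx, neg_mul_neg, mul_assoc, ← mul_assoc g, hgx]
    simp [← mul_assoc, hx2]
  let R : List (Fin n) → (T →ₐ[k] T) := fun l => l.foldr (fun j f => f.comp (Q j)) (AlgHom.id k T)
  have Rcons : ∀ j l h, R (j :: l) h = R l (Q j h) := fun j l h => rfl
  have RI : ∀ l, ∀ h ∈ I.carrier, R l h ∈ I.carrier := by
    intro l
    induction l with
    | nil => exact fun h hh => hh
    | cons j l ih => exact fun h hh => ih _ (hQI j h hh)
  have Rg : ∀ l, R l g = g := by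
    intro l
    induction l with
    | nil => rfl
    | cons j l ih => rw [Rcons, hQg, ih]
  have Rx : ∀ l i, i ∈ l → R l (x i) = 0 := by
    intro l
    induction l with
    | nil => simp
    | cons j l ih =>
      intro i hi
      by_cases hij : i = j
      · rw [Rcons, hij, hQx, map_zero]
      · rw [Rcons, hQi _ _ hij]; exact ih i (by simpa [hij] using hi)
  have Rspan : ∀ h, ∃ a b : k, R (List.finRange n) h = a • 1 + b • g := by
    intro h
    have hh : h ∈ Algebra.adjoin k ({g} ∪ Set.range x) := hgen ▸ Algebra.mem_top
    induction hh using Algebra.adjoin_induction with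
    | mem y hy =>
      rcases hy with rfl | ⟨i, rfl⟩
      · exact ⟨0, 1, by simp [Rg]⟩
      · exact ⟨0, 0, by simp [Rx _ i (List.mem_finRange i)]⟩
    | algebraMap r => exact ⟨r, 0, by simp [Algebra.algebraMap_eq_smul_one]⟩
    | add a b _ _ h1 h2 =>
      obtain ⟨c, d, h1⟩ := h1
      obtain ⟨c', d', h2⟩ := h2
      exact ⟨c + c', d + d', by rw [map_add, h1, h2]; module⟩
    | mul a b _ _ h1 h2 =>
      obtain ⟨c, d, h1⟩ := h1
      obtain ⟨c', d', h2⟩ := h2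
      refine ⟨c * c' + d * d', c * d' + d * c', ?_⟩
      rw [map_mul, h1, h2]
      simp only [add_mul, mul_add, smul_mul_smul_comm, hgg, one_mul, mul_one]
      module
  have R0 : ∀ h ∈ I.carrier, R (List.finRange n) h = 0 := by
    intro h hh
    have hz : ha.act (R (List.finRange n) h) = 0 := hI _ (RI _ h hh)
    obtain ⟨a, b, hab⟩ := Rspan h
    rw [hab] at hz ⊢
    have e1 := LinearMap.congr_fun hz 1
    have e2 := LinearMap.congr_fun hz u
    simp only [map_add, map_smul, map_one, LinearMap.add_apply, LinearMap.smul_apply,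
      Module.End.one_apply, ha.act_one, hcg, one_smul, LinearMap.zero_apply, hgu] at e1 e2
    rw [← add_smul] at e1
    have e3 : (a - b) • u = 0 := by rw [← e2]; module
    have f1 := (smul_eq_zero.1 e1).resolve_right one_ne_zero
    have f2 := (smul_eq_zero.1 e3).resolve_right hu
    have fa : a = 0 := by
      have : (2 : k) * a = 0 := by linear_combination f1 + f2
      simpa using this
    have fb : b = 0 := by rw [fa] at f1; simpa using f1
    simp [fa, fb]
  have final : ∀ l, (∀ h ∈ I.carrier, R l h = 0) → ∀ h ∈ I.carrier, h = 0 := by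
    intro l
    induction l with
    | nil => exact fun H h hh => H h hh
    | cons j l ih =>
      intro H
      apply ih
      have step : ∀ h ∈ I.carrier,
          R l h = R l (E (F (some j)) (Coalgebra.comul (R := k) h)) * R l (g * x j) := by
        intro h hh
        conv_lhs => rw [hQ1 j h, map_add, ← Rcons, H h hh, zero_add, map_mul]
      intro h hh
      rw [step h hh, step _ (hD j h hh), mul_assoc, ← map_mul, yy, map_zero, mul_zero]
  rw [eq_bot_iff]
  exact fun h hh => (Submodule.mem_bot k).2 (final _ R0 h hh)

end faithful

section main
variable {k T : Type} [Field k] [Ring T] [HopfAlgebra k T]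

theorem exists_indep [IsAlgClosed k] (n : ℕ) (F : Type) [Field F] [Algebra k F] (v : F)
    (hv : ¬∃ f : F, f ^ 2 = v) : ∃ w : Fin n → F, LinearIndependent k w := by
  have hinf : ¬ Module.Finite k F := fun hfin => by
    obtain ⟨c, rfl⟩ := (IsAlgClosed.algebraMap_bijective_of_isIntegral (k := k) (K := F)).2 v
    obtain ⟨d, hd⟩ := IsAlgClosed.exists_pow_nat_eq c (n := 2) two_pos
    exact hv ⟨algebraMap k F d, by rw [← map_pow, hd]⟩
  let b := Module.Basis.ofVectorSpace k F
  have : Infinite (Module.Basis.ofVectorSpaceIndex k F) := by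
    by_contra hc
    rw [not_infinite_iff_finite] at hc
    exact hinf (Module.Finite.of_basis b)
  exact ⟨fun i => b (Infinite.natEmbedding _ (i : ℕ)), b.linearIndependent.comp _
    ((Infinite.natEmbedding _).injective.comp Fin.val_injective)⟩

open QuadraticAlgebra in
theorem exists_witness [IsAlgClosed k] [CharZero k] {n : ℕ} {g : T} {x : Fin n → T}
    (hg : IsGrouplike k g)
    (hx : ∀ i : Fin n, Coalgebra.comul (R := k) (x i) = g ⊗ₜ[k] (x i) + (x i) ⊗ₜ[k] (1 : T))
    (hg2 : g ^ 2 = 1) (hx2 : ∀ i : Fin n, x i * x i = 0)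
    (hgx : ∀ i : Fin n, g * x i = -(x i * g))
    (hxx : ∀ i j : Fin n, x i * x j = -(x j * x i))
    (hgen : Algebra.adjoin k ({g} ∪ Set.range x) = ⊤)
    (hdim : Module.finrank k T = 2 ^ (n + 1))
    (F : Type) [Field F] [Algebra k F] (v : F) (hv : ¬∃ f : F, f ^ 2 = v) :
    Nonempty (NicholsExtensionWitness k T n g x F v) := by
  obtain ⟨w, hw⟩ := exists_indep (k := k) n F v hv
  have : Fact (∀ r : F, r ^ 2 ≠ v + 0 * r) := ⟨fun r h => hv ⟨r, by simpa using h⟩⟩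
  have hcF : CharZero F := charZero_of_injective_algebraMap (algebraMap k F).injective
  let G : Module.End k (QuadraticAlgebra F v 0) :=
    { toFun := fun z => ⟨z.re, -z.im⟩
      map_add' := fun a b => by ext <;> simp [add_comm]
      map_smul' := fun r a => by ext <;> simp }
  let X : Fin n → Module.End k (QuadraticAlgebra F v 0) := fun i =>
    { toFun := fun z => ⟨w i * z.im, 0⟩
      map_add' := fun a b => by ext <;> simp [mul_add]
      map_smul' := fun r a => by ext <;> simp }
  have hG : ∀ z, G z = ⟨z.re, -z.im⟩ := fun z => rfl
  have hX : ∀ i z, X i z = ⟨w i * z.im, 0⟩ := fun i z => rfl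
  obtain ⟨f, hfg, hfx⟩ := exists_lift g x hg2 hgx hxx hgen hdim G X
    (by ext z <;> simp [hG]) (fun i => by ext z <;> simp [hG, hX])
    (fun i j => by ext z <;> simp [hX])
  let ha : HopfAction k T (QuadraticAlgebra F v 0) := mkAction hg hx hgen f
    (fun a b => by rw [hfg]; ext <;> simp [hG]; ring)
    (fun i a b => by rw [hfg, hfx]; ext <;> simp [hG, hX] <;> ring)
    (by rw [hfg]; ext <;> simp [hG]) (fun i => by rw [hfx]; ext <;> simp [hX])
  have hag : ha.act g = G := hfg
  have hax : ∀ i, ha.act (x i) = X i := hfx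
  let emb : F →ₐ[k] (QuadraticAlgebra F v 0) := IsScalarTower.toAlgHom k F (QuadraticAlgebra F v 0)
  have hemb : ∀ r, emb r = ⟨r, 0⟩ := fun r => rfl
  have hembinj : Function.Injective emb := emb.toRingHom.injective
  refine ⟨{ L := (QuadraticAlgebra F v 0), emb := emb, action := ha, u := ⟨0, 1⟩, w := w, w_indep := hw,
            faithful := ?_, u_sq := ?_, act_g_u := ?_, act_x_u := ?_, inv_eq := ?_, gen := ?_ }⟩
  · refine faithful_of hg hx hg2 hx2 hgx hxx hgen ha ⟨0, 1⟩ (fun i => emb (w i)) ?_ ?_ ?_ ?_ ?_ ?_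
    · intro h; simpa using congrArg QuadraticAlgebra.im h
    · exact hw.map' emb.toLinearMap (LinearMap.ker_eq_bot.2 hembinj)
    · rw [hag]; ext <;> simp [hG]
    · intro i; rw [hax, hemb]; ext <;> simp [hX]
    · intro i; rw [hag, hemb]; ext <;> simp [hG]
    · intro i j; rw [hax, hemb]; ext <;> simp [hX]
  · rw [hemb, sq]; ext <;> simp
  · rw [hag]; ext <;> simp [hG]
  · intro i; rw [hax, hemb]; ext <;> simp [hX]
  · ext z
    constructor
    · rintro ⟨r, rfl⟩ h
      have hh : h ∈ Algebra.adjoin k ({g} ∪ Set.range x) := hgen ▸ Algebra.mem_top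
      induction hh using Algebra.adjoin_induction with
      | mem y hy =>
        rcases hy with rfl | ⟨i, rfl⟩
        · rw [hag, counit_g hg, hemb]; ext <;> simp [hG]
        · rw [hax, counit_s hg (hx i), hemb]; ext <;> simp [hX]
      | algebraMap r => simp
      | add a b _ _ h1 h2 => rw [map_add, map_add, LinearMap.add_apply, h1, h2, add_smul]
      | mul a b _ _ h1 h2 =>
        rw [map_mul, Module.End.mul_apply, h2, map_smul, h1, Bialgebra.counit_mul, mul_smul]
        exact smul_comm _ _ _
    · intro hz
      have h1 := hz g
      rw [hag, counit_g hg, one_smul, hG] at h1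
      have h2 : -z.im = z.im := congrArg QuadraticAlgebra.im h1
      refine ⟨z.re, ?_⟩
      rw [hemb]
      ext
      · rfl
      · exact (self_eq_neg.1 h2.symm).symm
  · rw [eq_top_iff]
    intro z _
    have : z = emb z.re + emb z.im * ⟨0, 1⟩ := by
      rw [hemb, hemb]; ext <;> simp
    rw [this]
    exact add_mem (Algebra.subset_adjoin (Or.inl ⟨_, rfl⟩))
      (mul_mem (Algebra.subset_adjoin (Or.inl ⟨_, rfl⟩)) (Algebra.subset_adjoin (Or.inr rfl)))

theorem ratFunc_X (k : Type) [Field k] : ¬∃ f : RatFunc k, f ^ 2 = RatFunc.X := by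
  rintro ⟨f, hf⟩
  have hf0 : f ≠ 0 := by
    rintro rfl
    exact RatFunc.X_ne_zero (by rw [← hf]; simp)
  have h := congrArg RatFunc.intDegree hf
  rw [sq, RatFunc.intDegree_mul hf0 hf0, RatFunc.intDegree_X] at h
  omega

theorem structure_thm [CharZero k] {n : ℕ} {g : T} {x : Fin n → T}
    (hg : IsGrouplike k g)
    (hx : ∀ i : Fin n, Coalgebra.comul (R := k) (x i) = g ⊗ₜ[k] (x i) + (x i) ⊗ₜ[k] (1 : T))
    (hg2 : g ^ 2 = 1)
    (hgx : ∀ i : Fin n, g * x i = -(x i * g))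
    (hgen : Algebra.adjoin k ({g} ∪ Set.range x) = ⊤)
    (hg1 : g ≠ 1) (hxi : LinearIndependent k x)
    (L : Type) [Field L] [Algebra k L] (ha : HopfAction k T L)
    (hf : InnerFaithful k ha.act.toLinearMap) :
      ∃ (F : IntermediateField k L) (u : L) (w : Fin n → L),
        (F : Set L) = ha.invariants ∧
        u ≠ 0 ∧
        ha.act g u = -u ∧
        (∀ i : Fin n, ha.act (x i) u = w i) ∧
        (∀ i : Fin n, w i ∈ F) ∧
        LinearIndependent k w ∧
        (∀ r ∈ F, ha.act g r = r ∧ ∀ i : Fin n, ha.act (x i) r = 0) ∧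
        u ^ 2 ∈ F ∧ u ^ 2 ≠ 0 ∧
        (¬∃ s ∈ F, s ^ 2 = u ^ 2) ∧
        Algebra.adjoin (↥F) {u} = ⊤ ∧
        IsGalois F L ∧ Module.finrank (↥F) L = 2 := by
  have hcL : CharZero L := charZero_of_injective_algebraMap (algebraMap k L).injective
  have hgm : ∀ a b, ha.act g (a * b) = ha.act g a * ha.act g b := fun a b => by
    rw [ha.act_mul, hg.2]; simp
  have hxm : ∀ i a b, ha.act (x i) (a * b) = ha.act g a * ha.act (x i) b + ha.act (x i) a * b :=
    fun i a b => by rw [ha.act_mul, hx]; simp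
  have hgg : ∀ a, ha.act g (ha.act g a) = a := fun a => by
    rw [← Module.End.mul_apply, ← map_mul, ← sq, hg2]; simp
  let σ : L →ₐ[k] L := AlgHom.ofLinearMap (ha.act g)
    (by rw [ha.act_one, counit_g hg, one_smul]) hgm
  have hσ : ∀ a, σ a = ha.act g a := fun a => rfl
  -- nontriviality of σ
  have hne : ∃ a, ha.act g a ≠ a := by
    by_contra hc
    push Not at hc
    refine hg1 (sub_eq_zero.1 (eq_zero_of_act (s := g - 1) hg ?_ ha hf ?_))
    · rw [map_sub, hg.2, Bialgebra.comul_one, Algebra.TensorProduct.one_def, tmul_sub, sub_tmul]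
      abel
    · ext a; simp [hc]
  obtain ⟨a₀, ha₀⟩ := hne
  obtain ⟨u, rfl⟩ : ∃ u, u = a₀ - ha.act g a₀ := ⟨_, rfl⟩
  generalize hu' : a₀ - ha.act g a₀ = u
  have hu : u ≠ 0 := by rw [← hu']; exact sub_ne_zero.2 ha₀.symm
  have hgu : ha.act g u = -u := by rw [← hu', map_sub, hgg]; abel
  clear hu' ha₀ a₀
  have h2u : (2 : L) * u ≠ 0 := mul_ne_zero two_ne_zero hu
  have hδ : ∀ i b, ha.act (x i) b * (2 * u) = ha.act (x i) u * (b - ha.act g b) := by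
    intro i b
    have h1 := hxm i u b
    rw [mul_comm, hxm, hgu] at h1
    linear_combination h1
  let F : IntermediateField k L := (AlgHom.equalizer σ (AlgHom.id k L)).toIntermediateField
    (fun a h => by
      rw [AlgHom.mem_equalizer] at h ⊢
      rw [map_inv₀, h, map_inv₀])
  have hF : ∀ a, a ∈ F ↔ ha.act g a = a := fun a => Iff.rfl
  have hxF : ∀ r ∈ F, ∀ i, ha.act (x i) r = 0 := fun r hr i => by
    have := hδ i r
    rw [(hF r).1 hr, sub_self, mul_zero] at this
    exact (mul_eq_zero.1 this).resolve_right h2u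
  have hdec : ∀ b : L, ∃ p q : F, b = p + q * u := by
    intro b
    refine ⟨⟨(b + ha.act g b) / 2, ?_⟩, ⟨(b - ha.act g b) / (2 * u), ?_⟩, ?_⟩
    · rw [hF, ← hσ, ← hσ, map_div₀, map_add, hσ (σ b), hσ b, hgg, map_ofNat, add_comm]
    · rw [hF, ← hσ, ← hσ, map_div₀, map_sub, map_mul, hσ (σ b), hσ b, hgg, map_ofNat, hσ u, hgu]
      rw [mul_neg, div_neg, ← neg_div, neg_sub]
    · push_cast
      field_simp
      ring
  have hadj : Algebra.adjoin (↥F) {u} = ⊤ := by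
    rw [eq_top_iff]
    intro b _
    obtain ⟨p, q, rfl⟩ := hdec b
    exact add_mem (Subalgebra.algebraMap_mem _ p) (mul_mem (Subalgebra.algebraMap_mem _ q)
      (Algebra.subset_adjoin rfl))
  have hrank : Module.finrank F L = 2 := by
    have hli : LinearIndependent F ![1, u] := by
      rw [LinearIndependent.pair_iff]
      intro s t h
      have h' : (s : L) + t * u = 0 := by simpa [Algebra.smul_def] using h
      have h2 := congrArg σ h'
      rw [map_add, map_mul, map_zero, hσ s, hσ t, hσ u, hgu, (hF _).1 s.2, (hF _).1 t.2] at h2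
      have hs : (2 : L) * s = 0 := by linear_combination h' + h2
      have ht : (t : L) * (2 * u) = 0 := by linear_combination h' - h2
      exact ⟨by simpa using hs, by simpa [hu] using ht⟩
    have hsp : ⊤ ≤ Submodule.span F (Set.range ![(1 : L), u]) := by
      intro b _
      obtain ⟨p, q, rfl⟩ := hdec b
      rw [Matrix.range_cons, Matrix.range_cons, Matrix.range_empty, Set.union_empty,
        Set.singleton_union, Submodule.mem_span_pair]
      exact ⟨p, q, by simp [Algebra.smul_def]⟩
    rw [Module.finrank_eq_card_basis (Module.Basis.mk hli hsp), Fintype.card_fin]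
  have hquad : Algebra.IsQuadraticExtension F L := ⟨hrank⟩
  refine ⟨F, u, fun i => ha.act (x i) u, ?_, hu, hgu, fun i => rfl, ?_, ?_, ?_, ?_, ?_, ?_,
    hadj, inferInstance, hrank⟩
  · ext r
    constructor
    · intro hr h
      have hr' : r ∈ F := hr
      have hh : h ∈ Algebra.adjoin k ({g} ∪ Set.range x) := hgen ▸ Algebra.mem_top
      induction hh using Algebra.adjoin_induction with
      | mem y hy =>
        rcases hy with rfl | ⟨i, rfl⟩
        · rw [(hF r).1 hr', counit_g hg, one_smul]
        · rw [hxF r hr', counit_s hg (hx i), zero_smul]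
      | algebraMap r => simp
      | add a b _ _ h1 h2 => rw [map_add, map_add, LinearMap.add_apply, h1, h2, add_smul]
      | mul a b _ _ h1 h2 =>
        rw [map_mul, Module.End.mul_apply, h2, map_smul, h1, Bialgebra.counit_mul, mul_smul]
        exact smul_comm _ _ _
    · intro hr
      have := hr g
      rw [counit_g hg, one_smul] at this
      exact (hF r).2 this
  · intro i
    rw [hF, ← Module.End.mul_apply, ← map_mul, hgx]
    simp [hgu]
  · rw [Fintype.linearIndependent_iff] at hxi ⊢
    intro c hc
    apply hxi
    refine eq_zero_of_act hg ?_ ha hf ?_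
    · simp only [map_sum, map_smul, hx, smul_add, Finset.sum_add_distrib, tmul_sum, sum_tmul,
        tmul_smul, smul_tmul']
    · ext b
      have h1 : ha.act (∑ i, c i • x i) b * (2 * u) = 0 := by
        have : ha.act (∑ i, c i • x i) b * (2 * u) =
            (∑ i, c i • ha.act (x i) u) * (b - ha.act g b) := by
          simp only [map_sum, map_smul, LinearMap.sum_apply, LinearMap.smul_apply,
            Finset.sum_mul, smul_mul_assoc, hδ]
        rw [this, hc, zero_mul]
      simpa using (mul_eq_zero.1 h1).resolve_right h2u
  · exact fun r hr => ⟨(hF r).1 hr, hxF r hr⟩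
  · rw [hF, sq, hgm, hgu, neg_mul_neg]
  · exact pow_ne_zero 2 hu
  · rintro ⟨s, hs, hsu⟩
    have huF : u ∈ F := by
      rcases sq_eq_sq_iff_eq_or_eq_neg.1 hsu with h | h
      · rwa [← h]
      · rw [h] at hs; simpa using F.neg_mem hs
    have := (hF u).1 huF
    rw [hgu] at this
    exact hu (self_eq_neg.1 this.symm)

end main

end NicholsAux

/-- **Statement 16.** The Nichols Hopf algebra `E(n)` (presented by a grouplike `g` and
`(g,1)`-skew primitive elements `x₁, …, x_n` with `g² = 1`, `x_i² = 0`, `g x_i = -x_i g`,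
`x_i x_j = -x_j x_i`, of dimension `2^{n+1}`) is Galois-theoretical; the fields `L` admitting
an inner faithful `E(n)`-action are precisely those of the form `L = F[u]/(u² - v)` with
`F = L^{E(n)}` and `v ∈ F^×` a nonsquare; the action satisfies `g ⬝ u = -u`,
`x_i ⬝ u = w_i ∈ F` with `w₁, …, w_n` linearly independent over `k`, and `g ⬝ r = r`,
`x_i ⬝ r = 0` for `r ∈ F`.  In particular `L` is a quadratic Galois extension of `F` with
Galois group `ℤ₂`. -/
theorem nichols_galoisTheoretical
    (k : Type) [Field k] [IsAlgClosed k] [CharZero k]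
    (n : ℕ) (hn : 1 ≤ n)
    (T : Type) [Ring T] [HopfAlgebra k T]
    (g : T) (x : Fin n → T)
    (hg : IsGrouplike k g)
    (hx : ∀ i : Fin n, Coalgebra.comul (R := k) (x i) = g ⊗ₜ[k] (x i) + (x i) ⊗ₜ[k] (1 : T))
    (hg2 : g ^ 2 = 1) (hx2 : ∀ i : Fin n, x i * x i = 0)
    (hgx : ∀ i : Fin n, g * x i = -(x i * g))
    (hxx : ∀ i j : Fin n, x i * x j = -(x j * x i))
    (hgen : Algebra.adjoin k ({g} ∪ Set.range x) = ⊤)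
    (hdim : Module.finrank k T = 2 ^ (n + 1)) :
    -- `E(n)` is Galois-theoretical
    GaloisTheoretical k T ∧
    -- every inner faithful `E(n)`-module field has the stated form
    (∀ (L : Type) [Field L] [Algebra k L] (ha : HopfAction k T L),
      InnerFaithful k ha.act.toLinearMap →
      ∃ (F : IntermediateField k L) (u : L) (w : Fin n → L),
        (F : Set L) = ha.invariants ∧
        u ≠ 0 ∧
        ha.act g u = -u ∧
        (∀ i : Fin n, ha.act (x i) u = w i) ∧
        (∀ i : Fin n, w i ∈ F) ∧
        LinearIndependent k w ∧
        (∀ r ∈ F, ha.act g r = r ∧ ∀ i : Fin n, ha.act (x i) r = 0) ∧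
        u ^ 2 ∈ F ∧ u ^ 2 ≠ 0 ∧
        (¬∃ s ∈ F, s ^ 2 = u ^ 2) ∧
        Algebra.adjoin (↥F) {u} = ⊤ ∧
        IsGalois F L ∧ Module.finrank (↥F) L = 2) ∧
    -- conversely, every field `F ⊇ k` with a nonsquare `v ∈ F^×` arises this way
    (∀ (F : Type) [Field F] [Algebra k F] (v : F), v ≠ 0 → (¬∃ f : F, f ^ 2 = v) →
      Nonempty (NicholsExtensionWitness k T n g x F v)) := by
  have hW : ∀ (F : Type) [Field F] [Algebra k F] (v : F), (¬∃ f : F, f ^ 2 = v) →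
      Nonempty (NicholsExtensionWitness k T n g x F v) := fun F _ _ v hv =>
    NicholsAux.exists_witness hg hx hg2 hx2 hgx hxx hgen hdim F v hv
  obtain ⟨W⟩ := hW (RatFunc k) RatFunc.X (NicholsAux.ratFunc_X k)
  obtain ⟨L₀, emb, action, faithful, u, u_sq, act_g_u, w, act_x_u, w_indep, inv_eq, gen⟩ := W
  rename_i fieldL algL
  refine ⟨⟨⟨L₀, action, faithful⟩⟩, ?_, fun F _ _ v _ hv => hW F v hv⟩
  have hcL : CharZero L₀ := charZero_of_injective_algebraMap (algebraMap k L₀).injective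
  have hu : u ≠ 0 := by
    rintro rfl
    rw [zero_pow two_ne_zero] at u_sq
    exact RatFunc.X_ne_zero (emb.toRingHom.injective (u_sq.symm.trans (map_zero emb).symm))
  have hg1 : g ≠ 1 := by
    intro h
    rw [h, map_one, Module.End.one_apply] at act_g_u
    exact hu (self_eq_neg.1 act_g_u)
  have hxi : LinearIndependent k x := by
    rw [Fintype.linearIndependent_iff] at w_indep ⊢
    intro c hc
    apply w_indep
    apply emb.toRingHom.injective
    have h := congrArg (fun t => action.act t u) hc
    have hz : emb (∑ i, c i • w i) = 0 := by
      rw [map_sum]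
      refine (Finset.sum_congr rfl fun i _ => emb.toLinearMap.map_smul (c i) (w i)).trans ?_
      simpa [act_x_u, LinearMap.sum_apply] using h
    exact hz.trans (map_zero emb).symm
  intro L _ _ ha hf
  exact NicholsAux.structure_thm hg hx hg2 hgx hgen hg1 hxi L ha hf
end

section
/- A book algebra h(ζ, p) is Galois-theoretical if and only if p = 1. In that case, any inner faithful h(ζ,1)-module field L is a cyclic degree-n Galois extension of its subfield of invariants L^{h(ζ,1)} with Galois group ℤ_n. -/
open TensorProduct

structure BookRel {k R : Type} [Field k] [Ring R] [Algebra k R] (n p : ℕ) (ζ : k)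
    (g x y : R) : Prop where
  gn : g ^ n = 1
  xn : x ^ n = 0
  yn : y ^ n = 0
  gx : g * x = ζ • (x * g)
  gy : g * y = ζ ^ p • (y * g)
  xy : x * y = y * x

def bookMon {R : Type} [Ring R] (n : ℕ) (g x y : R) (a : Fin n × Fin n × Fin n) : R :=
  x ^ (a.1 : ℕ) * y ^ (a.2.1 : ℕ) * g ^ (a.2.2 : ℕ)

section book
variable {k R : Type} [Field k] [Ring R] [Algebra k R] {n p : ℕ} {ζ : k} {g x y : R}

theorem skew_pow {g x : R} {ζ : k} (h : g * x = ζ • (x * g)) (i : ℕ) :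
    g * x ^ i = ζ ^ i • (x ^ i * g) := by
  induction i with
  | zero => simp
  | succ i ih =>
    rw [pow_succ, ← mul_assoc, ih, smul_mul_assoc, mul_assoc, h, mul_smul_comm, smul_smul,
      ← pow_succ, mul_assoc]

theorem BookRel.mon_mem (h : BookRel n p ζ g x y) (hn : 0 < n) (i j l : ℕ) :
    x ^ i * y ^ j * g ^ l ∈ Submodule.span k (Set.range (bookMon n g x y)) := by
  by_cases hi : i < n
  · by_cases hj : j < n
    · have : g ^ l = g ^ (l % n) := by
        conv_lhs => rw [← Nat.div_add_mod l n, pow_add, pow_mul, h.gn, one_pow, one_mul]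
      rw [this]
      exact Submodule.subset_span ⟨(⟨i, hi⟩, ⟨j, hj⟩, ⟨l % n, Nat.mod_lt _ hn⟩), rfl⟩
    · rw [pow_eq_zero_of_le (not_lt.mp hj) h.yn]; simp
  · rw [pow_eq_zero_of_le (not_lt.mp hi) h.xn]; simp

theorem BookRel.adjoin_le (h : BookRel n p ζ g x y) (hn : 0 < n) {r : R}
    (hr : r ∈ Algebra.adjoin k {g, x, y}) :
    r ∈ Submodule.span k (Set.range (bookMon n g x y)) := by
  have key : ∀ v ∈ Submodule.span k (Set.range (bookMon n g x y)),
      r * v ∈ Submodule.span k (Set.range (bookMon n g x y)) := by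
    induction hr using Algebra.adjoin_induction with
    | mem r hr =>
      intro v hv
      induction hv using Submodule.span_induction with
      | mem v hv =>
        obtain ⟨⟨i, j, l⟩, rfl⟩ := hv
        simp only [bookMon]
        rcases hr with rfl | rfl | rfl
        · rw [← mul_assoc, ← mul_assoc, skew_pow h.gx, smul_mul_assoc, mul_assoc _ r,
            skew_pow h.gy, mul_smul_comm, smul_mul_assoc, smul_mul_assoc]
          refine Submodule.smul_mem _ _ (Submodule.smul_mem _ _ ?_)
          have := h.mon_mem (k := k) hn i j (l + 1)
          simpa [pow_succ', mul_assoc] using this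
        · have := h.mon_mem (k := k) hn (i + 1) j l
          simpa [pow_succ', mul_assoc] using this
        · have := h.mon_mem (k := k) hn i (j + 1) l
          have e : r * (x ^ (i : ℕ) * r ^ (j : ℕ) * g ^ (l : ℕ))
              = x ^ (i : ℕ) * r ^ ((j : ℕ) + 1) * g ^ (l : ℕ) := by
            have c : Commute r (x ^ (i : ℕ)) := (Commute.pow_left h.xy i).symm
            rw [← mul_assoc, ← mul_assoc, c.eq, pow_succ', mul_assoc (x ^ (i : ℕ))]
          rw [e]; exact this
      | zero => simp
      | add a b _ _ ha hb => rw [mul_add]; exact Submodule.add_mem _ ha hb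
      | smul c a _ ha => rw [mul_smul_comm]; exact Submodule.smul_mem _ _ ha
    | algebraMap c =>
      intro v hv
      rw [← Algebra.smul_def]; exact Submodule.smul_mem _ _ hv
    | add a b _ _ ha hb =>
      intro v hv; rw [add_mul]; exact Submodule.add_mem _ (ha v hv) (hb v hv)
    | mul a b _ _ ha hb =>
      intro v hv; rw [mul_assoc]; exact ha _ (hb v hv)
  have := key 1 (by simpa using h.mon_mem (k := k) hn 0 0 0)
  simpa using this

theorem BookRel.linInd (h : BookRel n p ζ g x y) (hn : 0 < n)
    (hgen : Algebra.adjoin k {g, x, y} = ⊤) (hdim : Module.finrank k R = n ^ 3) :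
    LinearIndependent k (bookMon n g x y) := by
  apply linearIndependent_of_top_le_span_of_card_eq_finrank
  · intro r _
    exact h.adjoin_le hn (by rw [hgen]; trivial)
  · simp [hdim]; ring

theorem BookRel.exists_lift {R' : Type} [Ring R'] [Algebra k R'] {g' x' y' : R'}
    (h : BookRel n p ζ g x y) (hn : 0 < n)
    (hgen : Algebra.adjoin k {g, x, y} = ⊤) (hdim : Module.finrank k R = n ^ 3)
    (h' : BookRel n p ζ g' x' y') :
    ∃ f : R →ₐ[k] R', f g = g' ∧ f x = x' ∧ f y = y' := by
  have hb : BookRel (k := k) (R := R × R') n p ζ (g, g') (x, x') (y, y') := by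
    constructor
    · simp [h.gn, h'.gn, Prod.ext_iff]
    · simp [h.xn, h'.xn, Prod.ext_iff]
    · simp [h.yn, h'.yn, Prod.ext_iff]
    · simp [h.gx, h'.gx]
    · simp [h.gy, h'.gy]
    · simp [h.xy, h'.xy]
  have hli := h.linInd hn hgen hdim
  let B := Algebra.adjoin k {((g, g') : R × R'), (x, x'), (y, y')}
  let π : B →ₐ[k] R := (AlgHom.fst k R R').comp B.val
  have hsurj : Function.Surjective π := by
    rw [← AlgHom.range_eq_top, ← top_le_iff, ← hgen, Algebra.adjoin_le_iff]
    rintro r (rfl | rfl | rfl)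
    · exact ⟨⟨(_, g'), Algebra.subset_adjoin (by simp)⟩, rfl⟩
    · exact ⟨⟨(_, x'), Algebra.subset_adjoin (by simp)⟩, rfl⟩
    · exact ⟨⟨(_, y'), Algebra.subset_adjoin (by simp)⟩, rfl⟩
  have hinj : Function.Injective π := by
    rw [injective_iff_map_eq_zero]
    rintro ⟨b, hbB⟩ h0
    have hm := hb.adjoin_le hn hbB
    rw [Submodule.mem_span_range_iff_exists_fun] at hm
    obtain ⟨c, hc⟩ := hm
    have h1 : ∑ a, c a • bookMon n g x y a = 0 := by
      have : (AlgHom.fst k R R') b = 0 := h0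
      rw [← hc, map_sum] at this
      simpa [bookMon] using this
    have h2 := (Fintype.linearIndependent_iff.mp hli) c h1
    have : b = 0 := by rw [← hc]; simp [h2]
    ext <;> simp [this]
  let e := AlgEquiv.ofBijective π ⟨hinj, hsurj⟩
  refine ⟨((AlgHom.snd k R R').comp B.val).comp e.symm.toAlgHom, ?_, ?_, ?_⟩
  · have : e ⟨(g, g'), Algebra.subset_adjoin (by simp)⟩ = g := rfl
    have := (AlgEquiv.symm_apply_eq e).mpr this.symm
    simp [this]
  · have : e ⟨(x, x'), Algebra.subset_adjoin (by simp)⟩ = x := rfl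
    have := (AlgEquiv.symm_apply_eq e).mpr this.symm
    simp [this]
  · have : e ⟨(y, y'), Algebra.subset_adjoin (by simp)⟩ = y := rfl
    have := (AlgEquiv.symm_apply_eq e).mpr this.symm
    simp [this]

end book

section hopf
variable {k T : Type} [Field k] [Ring T] [HopfAlgebra k T]

def idealSpan (k : Type) {T : Type} [Field k] [Ring T] [Algebra k T] (x : T) : Submodule k T :=
  Submodule.span k {z | ∃ a b : T, z = a * x * b}

theorem mem_idealSpan (x a b : T) : a * x * b ∈ idealSpan k x :=
  Submodule.subset_span ⟨a, b, rfl⟩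

theorem counit_of_grouplike {g : T} (hg : IsGrouplike k g) :
    Coalgebra.counit (R := k) g = 1 := by
  have h := Coalgebra.rTensor_counit_comul (R := k) g
  rw [hg.2, LinearMap.rTensor_tmul] at h
  have h2 := congrArg (TensorProduct.lid k T) h
  simp only [TensorProduct.lid_tmul, one_smul] at h2
  have h3 : (Coalgebra.counit (R := k) g - 1) • g = 0 := by rw [sub_smul, h2, one_smul, sub_self]
  rcases smul_eq_zero.mp h3 with h4 | h4
  · exact sub_eq_zero.mp h4
  · exact absurd h4 hg.1

theorem counit_of_skew₁ {x u v : T} (hu : Coalgebra.counit (R := k) u = 1)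
    (hv : Coalgebra.counit (R := k) v = 1)
    (hx : Coalgebra.comul (R := k) x = u ⊗ₜ[k] x + x ⊗ₜ[k] v) :
    Coalgebra.counit (R := k) x = 0 := by
  have h := Coalgebra.rTensor_counit_comul (R := k) x
  rw [hx, map_add, LinearMap.rTensor_tmul, LinearMap.rTensor_tmul, hu] at h
  have h2 := congrArg (TensorProduct.lid k T) h
  simp only [map_add, TensorProduct.lid_tmul, one_smul, add_eq_left] at h2
  have h3 := congrArg (Coalgebra.counit (R := k)) h2
  simpa [hv] using h3

theorem antipode_of_skew {x u v v' : T}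
    (hx : Coalgebra.comul (R := k) x = u ⊗ₜ[k] x + x ⊗ₜ[k] v)
    (h0 : Coalgebra.counit (R := k) x = 0) (hv : v * v' = 1) :
    HopfAlgebra.antipode k x = (-(HopfAlgebra.antipode k u)) * x * v' := by
  have h := HopfAlgebra.mul_antipode_rTensor_comul_apply (R := k) x
  rw [hx, h0] at h
  simp only [map_add, LinearMap.rTensor_tmul, LinearMap.mul'_apply, map_zero] at h
  have h2 := eq_neg_of_add_eq_zero_right h
  calc HopfAlgebra.antipode k x = (HopfAlgebra.antipode k x * v) * v' := by
        rw [mul_assoc, hv, mul_one]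
    _ = _ := by rw [h2, neg_mul, neg_mul, neg_mul]

/-- the Hopf ideal generated by a skew primitive -/
def skewIdeal (x u v v' : T)
    (hx : Coalgebra.comul (R := k) x = u ⊗ₜ[k] x + x ⊗ₜ[k] v)
    (h0 : Coalgebra.counit (R := k) x = 0) (hv : v * v' = 1) : HopfIdeal k T where
  carrier := idealSpan k x
  mul_mem_left := by
    intro a z hz
    induction hz using Submodule.span_induction with
    | mem z hz =>
      obtain ⟨b, c, rfl⟩ := hz
      rw [← mul_assoc, ← mul_assoc]; exact mem_idealSpan _ _ _
    | zero => simp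
    | add a b _ _ ha hb => rw [mul_add]; exact Submodule.add_mem _ ha hb
    | smul c a _ ha => rw [mul_smul_comm]; exact Submodule.smul_mem _ _ ha
  mul_mem_right := by
    intro a z hz
    induction hz using Submodule.span_induction with
    | mem z hz =>
      obtain ⟨b, c, rfl⟩ := hz
      rw [mul_assoc]; exact mem_idealSpan _ _ _
    | zero => simp
    | add a b _ _ ha hb => rw [add_mul]; exact Submodule.add_mem _ ha hb
    | smul c a _ ha => rw [smul_mul_assoc]; exact Submodule.smul_mem _ _ ha
  comul_mem := by
    intro z hz
    induction hz using Submodule.span_induction with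
    | mem z hz =>
      obtain ⟨a, b, rfl⟩ := hz
      rw [Bialgebra.comul_mul, Bialgebra.comul_mul, hx]
      generalize Coalgebra.comul (R := k) a = A
      generalize Coalgebra.comul (R := k) b = B
      induction A using TensorProduct.induction_on with
      | zero => simp
      | add A A' hA hA' => rw [add_mul, add_mul]; exact Submodule.add_mem _ hA hA'
      | tmul a a' =>
        induction B using TensorProduct.induction_on with
        | zero => simp
        | add A A' hA hA' => rw [mul_add]; exact Submodule.add_mem _ hA hA'
        | tmul b b' =>
          simp only [mul_add, add_mul, Algebra.TensorProduct.tmul_mul_tmul]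
          rw [add_comm]
          refine Submodule.add_mem_sup ?_ ?_
          · exact ⟨(⟨_, mem_idealSpan x a b⟩ : idealSpan k x) ⊗ₜ (a' * v * b'), by simp⟩
          · exact ⟨(a * u * b) ⊗ₜ (⟨_, mem_idealSpan x a' b'⟩ : idealSpan k x), by simp⟩
    | zero => simp
    | add a b _ _ ha hb => rw [map_add]; exact Submodule.add_mem _ ha hb
    | smul c a _ ha => rw [map_smul]; exact Submodule.smul_mem _ _ ha
  counit_eq_zero := by
    intro z hz
    induction hz using Submodule.span_induction with
    | mem z hz =>
      obtain ⟨a, b, rfl⟩ := hz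
      simp [Bialgebra.counit_mul, h0]
    | zero => simp
    | add a b _ _ ha hb => rw [map_add, ha, hb, add_zero]
    | smul c a _ ha => rw [map_smul, ha, smul_zero]
  antipode_mem := by
    intro z hz
    induction hz using Submodule.span_induction with
    | mem z hz =>
      obtain ⟨a, b, rfl⟩ := hz
      rw [HopfAlgebra.antipode_mul_antidistrib, HopfAlgebra.antipode_mul_antidistrib,
        antipode_of_skew hx h0 hv]
      have := mem_idealSpan (k := k) x (HopfAlgebra.antipode k b * (-(HopfAlgebra.antipode k u)))
        (v' * HopfAlgebra.antipode k a)
      simpa only [mul_assoc] using this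
    | zero => simp
    | add a b _ _ ha hb => rw [map_add]; exact Submodule.add_mem _ ha hb
    | smul c a _ ha => rw [map_smul]; exact Submodule.smul_mem _ _ ha

theorem act_ne_zero {M : Type} [AddCommGroup M] [Module k M] (ρ : T →ₐ[k] Module.End k M)
    (hf : InnerFaithful k ρ.toLinearMap) {x u v v' : T}
    (hx : Coalgebra.comul (R := k) x = u ⊗ₜ[k] x + x ⊗ₜ[k] v)
    (h0 : Coalgebra.counit (R := k) x = 0) (hv : v * v' = 1) (hne : x ≠ 0) : ρ x ≠ 0 := by
  intro hz
  have := hf (skewIdeal x u v v' hx h0 hv) (by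
    intro z hz'
    change z ∈ idealSpan k x at hz'
    induction hz' using Submodule.span_induction with
    | mem z hz' =>
      obtain ⟨a, b, rfl⟩ := hz'
      simp [hz]
    | zero => simp
    | add a b _ _ ha hb => rw [map_add, ha, hb, add_zero]
    | smul c a _ ha => rw [map_smul, ha, smul_zero])
  have hm : x ∈ idealSpan k x := by simpa using mem_idealSpan (k := k) x 1 1
  rw [show idealSpan k x = ⊥ from this] at hm
  exact hne (by simpa using hm)

variable {L : Type} [Field L] [Algebra k L] (ha : HopfAction k T L)

theorem act_grouplike {g : T} (hg : Coalgebra.comul (R := k) g = g ⊗ₜ[k] g) (a b : L) :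
    ha.act g (a * b) = ha.act g a * ha.act g b := by
  rw [ha.act_mul, hg]; simp

theorem act_skew {x u v : T} (hx : Coalgebra.comul (R := k) x = u ⊗ₜ[k] x + x ⊗ₜ[k] v) (a b : L) :
    ha.act x (a * b) = ha.act u a * ha.act x b + ha.act x a * ha.act v b := by
  rw [ha.act_mul, hx]; simp

theorem comul_grouplike_pow {g : T} (hg : Coalgebra.comul (R := k) g = g ⊗ₜ[k] g) (p : ℕ) :
    Coalgebra.comul (R := k) (g ^ p) = (g ^ p) ⊗ₜ[k] (g ^ p) := by
  rw [Bialgebra.comul_pow, hg, Algebra.TensorProduct.tmul_pow]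

/-- Everything about an inner faithful action for x₁. -/
theorem exists_c {n : ℕ} (hn : 2 ≤ n) {ζ : k} (hζ : IsPrimitiveRoot ζ n) {g x : T}
    (hg : IsGrouplike k g)
    (hx : Coalgebra.comul (R := k) x = (1 : T) ⊗ₜ[k] x + x ⊗ₜ[k] g)
    (hgn : g ^ n = 1) (hgx : g * x = ζ • (x * g))
    (hne : ha.act x ≠ 0) :
    ∃ c : L, c ≠ 0 ∧ ha.act g c = ζ • c ∧ ∀ a, ha.act x a = c * (ha.act g a - a) := by
  have hζ1 : ζ ≠ 1 := hζ.ne_one (by omega)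
  have comm : ∀ a b, ha.act x a * (ha.act g b - b) = ha.act x b * (ha.act g a - a) := by
    intro a b
    have h1 := act_skew ha hx a b
    have h2 := act_skew ha hx b a
    rw [mul_comm b a, h1] at h2
    simp only [map_one, Module.End.one_apply] at h2
    linear_combination h2
  have hgx' : ∀ a, ha.act g (ha.act x a) = ζ • ha.act x (ha.act g a) := by
    intro a
    have := congrArg (fun z => ha.act z a) hgx
    simpa using this
  have hinj : ∀ a, ha.act g a = 0 → a = 0 := by
    intro a h
    have h1 : ha.act (g ^ n) a = a := by rw [hgn]; simp
    rw [show n = (n - 1) + 1 by omega, pow_succ, map_mul, Module.End.mul_apply, h, map_zero] at h1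
    exact h1.symm
  have hb : ∃ b, ha.act g b - b ≠ 0 := by
    by_contra! hcon
    apply hne
    ext a
    have h1 := hgx' a
    rw [sub_eq_zero.mp (hcon _), sub_eq_zero.mp (hcon _)] at h1
    have h3 : (ζ - 1) • ha.act x a = 0 := by rw [sub_smul, ← h1, one_smul, sub_self]
    rcases smul_eq_zero.mp h3 with h4 | h4
    · exact absurd (sub_eq_zero.mp h4) hζ1
    · simpa using h4
  obtain ⟨b, hb⟩ := hb
  have hform : ∀ a, ha.act x a = (ha.act x b / (ha.act g b - b)) * (ha.act g a - a) := by
    intro a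
    have := comm a b
    field_simp
    linear_combination this
  set c := ha.act x b / (ha.act g b - b) with hc
  refine ⟨c, ?_, ?_, hform⟩
  · intro h0
    apply hne
    ext a
    rw [hform, h0]; simp
  · have h1 := hgx' b
    rw [hform b, hform (ha.act g b), act_grouplike ha hg.2, ← smul_mul_assoc, ← map_sub] at h1
    exact mul_right_cancel₀ (fun h => hb (hinj _ h)) h1

theorem act_pow_c {g : T} {ζ : k} {c : L} (hc : ha.act g c = ζ • c) (i : ℕ) :
    ha.act (g ^ i) c = ζ ^ i • c := by
  induction i with
  | zero => simp
  | succ i ih => rw [pow_succ, map_mul, Module.End.mul_apply, hc, map_smul, ih, smul_smul, pow_succ']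

/-- `p = 1` is forced. -/
theorem p_eq_one {n p : ℕ} (hn : 2 ≤ n) (hp : 0 < p) (hpn : p < n)
    {ζ : k} (hζ : IsPrimitiveRoot ζ n) {g x₁ x₂ : T}
    (hg : IsGrouplike k g)
    (hx₁ : Coalgebra.comul (R := k) x₁ = (1 : T) ⊗ₜ[k] x₁ + x₁ ⊗ₜ[k] g)
    (hx₂ : Coalgebra.comul (R := k) x₂ = (g ^ p) ⊗ₜ[k] x₂ + x₂ ⊗ₜ[k] (1 : T))
    (hgn : g ^ n = 1) (hgx₁ : g * x₁ = ζ • (x₁ * g)) (hgx₂ : g * x₂ = ζ ^ p • (x₂ * g))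
    (hx₁x₂ : x₁ * x₂ = x₂ * x₁)
    (hne : ha.act x₁ ≠ 0) (hne2 : ha.act x₂ ≠ 0) : p = 1 := by
  obtain ⟨c, hc0, hgc, hform⟩ := exists_c ha hn hζ hg hx₁ hgn hgx₁ hne
  have hgpc := act_pow_c ha hgc p
  have hζp : ζ ^ p ≠ 1 := hζ.pow_ne_one_of_pos_of_lt hp.ne' hpn
  have hgp := comul_grouplike_pow hg.2 p
  have smul_eq : ∀ (s : k) (a : L), s • a = algebraMap k L s * a := fun s a => Algebra.smul_def s a
  have hZp : algebraMap k L (ζ ^ p) - 1 ≠ 0 := by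
    rw [← map_one (algebraMap k L), ← map_sub]
    exact fun h => hζp (sub_eq_zero.mp ((map_eq_zero _).mp h))
  -- form of x₂
  set d := ha.act x₂ c / (ha.act (g ^ p) c - c) with hd
  have hden : ha.act (g ^ p) c - c ≠ 0 := by
    rw [hgpc, smul_eq]
    intro h
    have : (algebraMap k L (ζ ^ p) - 1) * c = 0 := by linear_combination h
    rcases mul_eq_zero.mp this with h | h
    · exact hZp h
    · exact hc0 h
  have hform2 : ∀ a, ha.act x₂ a = d * (ha.act (g ^ p) a - a) := by
    intro a
    have h1 := act_skew ha hx₂ a c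
    have h2 := act_skew ha hx₂ c a
    rw [mul_comm c a, h1] at h2
    simp only [map_one, Module.End.one_apply] at h2
    rw [hd]
    field_simp
    linear_combination -h2
  have hd0 : d ≠ 0 := by
    intro h0
    apply hne2
    ext a
    rw [hform2, h0]; simp
  -- g d = ζ^p d
  have hgd : ha.act g d = ζ ^ p • d := by
    have h1 : ha.act g (ha.act x₂ c) = ζ ^ p • ha.act x₂ (ha.act g c) := by
      have := congrArg (fun z => ha.act z c) hgx₂
      simpa using this
    rw [hform2 c, act_grouplike ha hg.2, map_sub, hgc, map_smul, hform2 c, hgpc, map_smul, hgc] at h1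
    rw [hgpc] at hden
    simp only [smul_eq] at h1 hden ⊢
    have hz : algebraMap k L ζ ≠ 0 := by simpa using hζ.ne_zero (by omega)
    refine mul_right_cancel₀ (mul_ne_zero hz hden) ?_
    linear_combination h1
  -- evaluate commutation on c
  have h1 : ha.act x₁ (ha.act x₂ c) = ha.act x₂ (ha.act x₁ c) := by
    have := congrArg (fun z => ha.act z c) hx₁x₂
    simpa using this
  rw [hform2 c, hform c, hform, hform2, hgpc, hgc] at h1
  have e1 : d * (ζ ^ p • c - c) = (ζ ^ p - 1) • (d * c) := by
    simp only [smul_eq, map_sub, map_one]; ring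
  have e2 : c * (ζ • c - c) = (ζ - 1) • (c * c) := by
    simp only [smul_eq, map_sub, map_one]; ring
  rw [e1, e2, map_smul, map_smul, act_grouplike ha hg.2, act_grouplike ha hgp, hgd, hgc, hgpc] at h1
  simp only [smul_eq, map_sub, map_one] at h1
  set Z := algebraMap k L ζ with hZ
  rw [map_pow] at h1 hZp
  have h2 : (Z ^ p - 1) * (d * c * c) * (Z - Z ^ p) = 0 := by linear_combination -h1
  have h3 : Z - Z ^ p = 0 := by
    rcases mul_eq_zero.mp h2 with h | h
    · exact absurd h (mul_ne_zero hZp (mul_ne_zero (mul_ne_zero hd0 hc0) hc0))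
    · exact h
  have h4 : ζ ^ p = ζ ^ 1 := by
    apply (algebraMap k L).injective
    rw [map_pow, pow_one]; exact (sub_eq_zero.mp h3).symm
  exact hζ.pow_inj hpn (by omega) h4

end hopf

section galois
variable {k T : Type} [Field k] [Ring T] [HopfAlgebra k T]
variable {L : Type} [Field L] [Algebra k L]

theorem galois_of_aut {n : ℕ} (hn : 2 ≤ n) (σ : L ≃ₐ[k] L) (hσ : orderOf σ = n) :
    ∃ F : IntermediateField k L, (∀ a, a ∈ F ↔ σ a = a) ∧
        IsGalois F L ∧ Module.finrank (↥F) L = n ∧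
        Nonempty ((L ≃ₐ[F] L) ≃* Multiplicative (ZMod n)) := by
  let G := Subgroup.zpowers σ
  have hcard : Nat.card G = n := by rw [Nat.card_zpowers, hσ]
  haveI : Finite G := Nat.finite_of_card_ne_zero (by omega)
  haveI : Fintype G := Fintype.ofFinite G
  refine ⟨FixedPoints.intermediateField G, ?_, ?_, ?_, ?_⟩
  · intro a
    rw [FixedPoints.mem_intermediateField_iff]
    constructor
    · intro h; exact h ⟨σ, Subgroup.mem_zpowers σ⟩
    · intro h m
      have hle : G ≤ MulAction.stabilizer (L ≃ₐ[k] L) a := by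
        rw [Subgroup.zpowers_le]; exact h
      exact hle m.2
  · exact IsGalois.of_fixed_field L G
  · have := FixedPoints.finrank_eq_card G L
    rw [← Nat.card_eq_fintype_card, hcard] at this
    exact this
  · have e1 : G ≃* (L ≃ₐ[(FixedPoints.intermediateField G : IntermediateField k L)] L) :=
      FixedPoints.toAlgAutMulEquiv G L
    haveI : IsCyclic G := inferInstance
    have e2 := zmodCyclicMulEquiv (G := G) inferInstance
    rw [hcard] at e2
    exact ⟨e1.symm.trans e2.symm⟩

theorem act_eq_counit (ha : HopfAction k T L) {s : Set T} (hgen : Algebra.adjoin k s = ⊤) (a : L)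
    (hs : ∀ h ∈ s, ha.act h a = Coalgebra.counit (R := k) h • a) (h : T) :
    ha.act h a = Coalgebra.counit (R := k) h • a := by
  have hh : h ∈ Algebra.adjoin k s := by rw [hgen]; trivial
  induction hh using Algebra.adjoin_induction with
  | mem h hh => exact hs h hh
  | algebraMap c => simp
  | add u v _ _ hu hv => simp [hu, hv, add_smul]
  | mul u v _ _ hu hv => simp [hu, hv, smul_smul, mul_comm]

theorem book_galois (ha : HopfAction k T L) {n : ℕ} (hn : 2 ≤ n)
    {ζ : k} (hζ : IsPrimitiveRoot ζ n) {g x₁ x₂ : T}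
    (hg : IsGrouplike k g)
    (hx₁ : Coalgebra.comul (R := k) x₁ = (1 : T) ⊗ₜ[k] x₁ + x₁ ⊗ₜ[k] g)
    (hx₂ : Coalgebra.comul (R := k) x₂ = g ⊗ₜ[k] x₂ + x₂ ⊗ₜ[k] (1 : T))
    (hgn : g ^ n = 1) (hgx₁ : g * x₁ = ζ • (x₁ * g))
    (hgen : Algebra.adjoin k {g, x₁, x₂} = ⊤)
    (hne : ha.act x₁ ≠ 0) :
      ∃ F : IntermediateField k L,
        (F : Set L) = ha.invariants ∧
        IsGalois F L ∧ Module.finrank (↥F) L = n ∧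
        Nonempty ((L ≃ₐ[F] L) ≃* Multiplicative (ZMod n)) := by
  obtain ⟨c, hc0, hgc, hform⟩ := exists_c ha hn hζ hg hx₁ hgn hgx₁ hne
  have hζ1 : ζ ≠ 1 := hζ.ne_one (by omega)
  have hεg := counit_of_grouplike hg
  let f : L →ₐ[k] L := AlgHom.ofLinearMap (ha.act g) (by rw [ha.act_one, hεg, one_smul])
    (act_grouplike ha hg.2)
  let f' : L →ₐ[k] L := AlgHom.ofLinearMap (ha.act (g ^ (n - 1)))
    (by rw [ha.act_one, Bialgebra.counit_pow, hεg, one_pow, one_smul])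
    (act_grouplike ha (comul_grouplike_pow hg.2 _))
  let σ : L ≃ₐ[k] L := AlgEquiv.ofAlgHom f f'
    (by ext a
        change ha.act g (ha.act (g ^ (n - 1)) a) = a
        rw [← Module.End.mul_apply, ← map_mul, ← pow_succ', Nat.sub_add_cancel (by omega), hgn]
        simp)
    (by ext a
        change ha.act (g ^ (n - 1)) (ha.act g a) = a
        rw [← Module.End.mul_apply, ← map_mul, ← pow_succ, Nat.sub_add_cancel (by omega), hgn]
        simp)
  have hσa : ∀ a, σ a = ha.act g a := fun a => rfl
  have hσpow : ∀ (i : ℕ) a, (σ ^ i) a = ha.act (g ^ i) a := by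
    intro i
    induction i with
    | zero => simp
    | succ i ih => intro a; rw [pow_succ, AlgEquiv.mul_apply, ih, hσa, pow_succ]; simp
  have hord : orderOf σ = n := by
    rw [orderOf_eq_iff (by omega)]
    constructor
    · ext a; rw [hσpow, hgn]; simp
    · intro m hm hm0 h
      have h1 := hσpow m c
      rw [h, act_pow_c ha hgc] at h1
      have h3 : (ζ ^ m - 1) • c = 0 := by rw [sub_smul, ← h1, one_smul]; simp
      rcases smul_eq_zero.mp h3 with h4 | h4
      · exact hζ.pow_ne_one_of_pos_of_lt hm0.ne' hm (sub_eq_zero.mp h4)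
      · exact hc0 h4
  obtain ⟨F, hF, h1, h2, h3⟩ := galois_of_aut hn σ hord
  refine ⟨F, ?_, h1, h2, h3⟩
  ext a
  rw [SetLike.mem_coe, hF, hσa]
  constructor
  · intro hfix
    refine act_eq_counit ha hgen a ?_
    rintro h (rfl | rfl | rfl)
    · rw [hfix, hεg, one_smul]
    · rw [hform, hfix, counit_of_skew₁ (by simp) hεg hx₁]; simp
    · rw [counit_of_skew₁ hεg (by simp) hx₂, zero_smul]
      have e1 := act_skew ha hx₂ a c
      have e2 := act_skew ha hx₂ c a
      rw [mul_comm c a, e1] at e2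
      simp only [map_one, Module.End.one_apply, hfix, hgc] at e2
      have : ha.act h a * ((algebraMap k L ζ - 1) * c) = 0 := by
        rw [Algebra.smul_def] at e2
        linear_combination -e2
      rcases mul_eq_zero.mp this with h | h
      · exact h
      · exfalso
        rcases mul_eq_zero.mp h with h | h
        · apply hζ1
          apply (algebraMap k L).injective
          rw [map_one]; exact sub_eq_zero.mp h
        · exact hc0 h
  · intro h
    have := h g
    rwa [hεg, one_smul] at this

end galois

section laurent
variable {k : Type} [Field k]

@[reducible] noncomputable instance lsAlg : Algebra k (LaurentSeries k) :=
  HahnSeries.instAlgebra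

def sigL (ζ : k) : LaurentSeries k →ₗ[k] LaurentSeries k where
  toFun f :=
    { coeff := fun m => ζ ^ m * f.coeff m
      isPWO_support' := f.isPWO_support.mono (by
        intro m hm h
        exact hm (by simp only [h, mul_zero])) }
  map_add' f f' := by ext m; simp [mul_add]
  map_smul' c f := by ext m; simp; ring

theorem sigL_coeff (ζ : k) (f : LaurentSeries k) (m : ℤ) :
    (sigL ζ f).coeff m = ζ ^ m * f.coeff m := rfl

theorem sigL_mul {ζ : k} (hζ : ζ ≠ 0) (a b : LaurentSeries k) :
    sigL ζ (a * b) = sigL ζ a * sigL ζ b := by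
  have hs : ∀ f : LaurentSeries k, (sigL ζ f).support ⊆ f.support := by
    intro f m hm h
    exact hm (by rw [sigL_coeff, h, mul_zero])
  ext m
  rw [sigL_coeff, HahnSeries.coeff_mul, HahnSeries.coeff_mul_left' a.isPWO_support (hs a)]
  rw [Finset.mul_sum]
  have hsub : Finset.antidiagonal a.isPWO_support (sigL ζ b).isPWO_support m
      ⊆ Finset.antidiagonal a.isPWO_support b.isPWO_support m := by
    intro ij h
    rw [Finset.mem_antidiagonal] at h ⊢
    exact ⟨h.1, hs b h.2.1, h.2.2⟩
  rw [Finset.sum_subset hsub]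
  · refine Finset.sum_congr rfl fun ij hij => ?_
    rw [Finset.mem_antidiagonal] at hij
    rw [sigL_coeff, sigL_coeff, ← hij.2.2, zpow_add₀ hζ]; ring
  · intro ij h1 h2
    rw [Finset.mem_antidiagonal] at h1 h2
    have : (sigL ζ b).coeff ij.2 = 0 := by
      by_contra hne
      exact h2 ⟨h1.1, hne, h1.2.2⟩
    rw [this, mul_zero]

theorem sigL_one (ζ : k) : sigL ζ (1 : LaurentSeries k) = 1 := by
  ext m
  rw [sigL_coeff, HahnSeries.coeff_one]
  split_ifs with h <;> simp [h]

noncomputable def dOp (ζ : k) (r : ℤ) : Module.End k (LaurentSeries k) :=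
  (LinearMap.mulLeft k (HahnSeries.single r (1 : k) : LaurentSeries k)) ∘ₗ (sigL ζ - LinearMap.id)

theorem dOp_apply (ζ : k) (r : ℤ) (f : LaurentSeries k) :
    dOp ζ r f = (HahnSeries.single r (1 : k) : LaurentSeries k) * (sigL ζ f - f) := rfl

theorem dOp_coeff {ζ : k} (hζ : ζ ≠ 0) {r : ℤ} (hr : ζ ^ r = ζ) (f : LaurentSeries k) (m : ℤ) :
    (dOp ζ r f).coeff m = (ζ ^ (m - 1) - 1) * f.coeff (m - r) := by
  have h := HahnSeries.coeff_single_mul_add (r := (1 : k)) (x := (sigL ζ f - f)) (a := m - r) (b := r)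
  rw [sub_add_cancel] at h
  rw [dOp_apply, h, one_mul, HahnSeries.coeff_sub, sigL_coeff, zpow_sub₀ hζ, hr, zpow_sub₀ hζ,
    zpow_one]
  ring

theorem dOp_pow_coeff {ζ : k} (hζ : ζ ≠ 0) {r : ℤ} (hr : ζ ^ r = ζ) (i : ℕ)
    (f : LaurentSeries k) (m : ℤ) :
    ((dOp ζ r ^ i) f).coeff m =
      (∏ s ∈ Finset.range i, (ζ ^ (m - 1 - s) - 1)) * f.coeff (m - i * r) := by
  induction i generalizing m with
  | zero => simp
  | succ i ih =>
    rw [pow_succ', Module.End.mul_apply, dOp_coeff hζ hr, ih, Finset.prod_range_succ']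
    have e : ∀ s : ℕ, ζ ^ (m - r - 1 - (s : ℤ)) = ζ ^ (m - 1 - ((s + 1 : ℕ) : ℤ)) := by
      intro s
      rw [show m - r - 1 - (s : ℤ) = (m - 1 - s) - r by ring, zpow_sub₀ hζ, hr,
        show m - 1 - ((s + 1 : ℕ) : ℤ) = (m - 1 - s) - 1 by push_cast; ring, zpow_sub₀ hζ (m - 1 - s),
        zpow_one]
    simp only [e]
    rw [show m - r - i * r = m - ((i + 1 : ℕ) : ℤ) * r by push_cast; ring]
    simp
    ring

theorem sigL_pow_coeff (ζ : k) (i : ℕ) (f : LaurentSeries k) (m : ℤ) :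
    (((sigL ζ : Module.End k (LaurentSeries k)) ^ i) f).coeff m = (ζ ^ i) ^ m * f.coeff m := by
  induction i with
  | zero => simp
  | succ i ih =>
    rw [pow_succ', Module.End.mul_apply, sigL_coeff, ih, pow_succ', mul_zpow]; ring

theorem laurent_rel {n : ℕ} (hn : 2 ≤ n) {ζ : k} (hζ : IsPrimitiveRoot ζ n) :
    BookRel n 1 ζ (sigL ζ : Module.End k (LaurentSeries k)) (dOp ζ 1) (dOp ζ (n + 1)) := by
  have h0 : ζ ≠ 0 := hζ.ne_zero (by omega)
  have hr1 : ζ ^ (1 : ℤ) = ζ := zpow_one ζ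
  have hr2 : ζ ^ ((n : ℤ) + 1) = ζ := by rw [zpow_add₀ h0]; simp [hζ.pow_eq_one]
  have nil : ∀ r : ℤ, ζ ^ r = ζ → dOp ζ r ^ n = 0 := by
    intro r hr
    ext f m
    rw [dOp_pow_coeff h0 hr, Finset.prod_eq_zero (i := ((m - 1) % n).toNat)]
    · simp
    · rw [Finset.mem_range]
      have := Int.emod_lt_of_pos (m - 1) (show (0 : ℤ) < n by omega)
      have := Int.emod_nonneg (m - 1) (show (n : ℤ) ≠ 0 by omega)
      omega
    · rw [sub_eq_zero, hζ.zpow_eq_one_iff_dvd, Int.toNat_of_nonneg (Int.emod_nonneg _ (by omega))]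
      exact Int.dvd_self_sub_emod
  have gd : ∀ r : ℤ, ζ ^ r = ζ → (sigL ζ : Module.End k (LaurentSeries k)) * dOp ζ r
      = ζ • (dOp ζ r * sigL ζ) := by
    intro r hr
    ext f m
    simp only [Module.End.mul_apply, LinearMap.smul_apply, HahnSeries.coeff_smul, sigL_coeff,
      dOp_coeff h0 hr, smul_eq_mul, zpow_sub₀ h0 m r, hr]
    field_simp
  constructor
  · ext f m
    rw [sigL_pow_coeff, hζ.pow_eq_one]; simp
  · exact nil _ hr1
  · exact nil _ hr2
  · exact gd _ hr1
  · rw [pow_one]; exact gd _ hr2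
  · ext f m
    simp only [Module.End.mul_apply, dOp_coeff h0 hr1, dOp_coeff h0 hr2]
    rw [show m - 1 - (n + 1 : ℤ) = m - (n + 1) - 1 by ring,
      show m - (n + 1 : ℤ) - 1 = m - 1 - (n + 1) by ring, zpow_sub₀ h0 (m - 1) (n + 1), hr2,
      zpow_sub₀ h0 (m - 1) 1, hr1]

end laurent

section action
variable {k T A : Type} [Field k] [Ring T] [HopfAlgebra k T] [Ring A] [Algebra k A]

def mulMap (ρ : T →ₐ[k] Module.End k A) (a b : A) : T ⊗[k] T →ₗ[k] A :=
  LinearMap.mul' k A ∘ₗ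
      (TensorProduct.map ((ρ.toLinearMap : T →ₗ[k] A →ₗ[k] A).flip a)
        ((ρ.toLinearMap : T →ₗ[k] A →ₗ[k] A).flip b))

theorem mulMap_tmul (ρ : T →ₐ[k] Module.End k A) (a b : A) (u v : T) :
    mulMap ρ a b (u ⊗ₜ v) = ρ u a * ρ v b := by simp [mulMap]

theorem mulMap_mul (ρ : T →ₐ[k] Module.End k A) (a b : A) (z : T ⊗[k] T) (u v : T) :
    mulMap ρ a b (z * (u ⊗ₜ v)) = mulMap ρ (ρ u a) (ρ v b) z := by
  induction z using TensorProduct.induction_on with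
  | zero => simp
  | add z z' h h' => rw [add_mul, map_add, map_add, h, h']
  | tmul x y => simp [mulMap_tmul]

theorem mulMap_comul (ρ : T →ₐ[k] Module.End k A) {h : T}
    (hh : ∀ a b, ρ h (a * b) = mulMap ρ a b (Coalgebra.comul (R := k) h)) (a b : A)
    (z : T ⊗[k] T) : ρ h (mulMap ρ a b z) = mulMap ρ a b (Coalgebra.comul (R := k) h * z) := by
  induction z using TensorProduct.induction_on with
  | zero => simp
  | add z z' h h' => rw [mul_add, map_add, map_add, map_add, h, h']
  | tmul x y => rw [mulMap_tmul, hh, mulMap_mul]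

def mkAction (ρ : T →ₐ[k] Module.End k A) {s : Set T} (hgen : Algebra.adjoin k s = ⊤)
    (hm : ∀ h ∈ s, ∀ a b, ρ h (a * b) = mulMap ρ a b (Coalgebra.comul (R := k) h))
    (h1 : ∀ h ∈ s, ρ h 1 = Coalgebra.counit (R := k) h • (1 : A)) : HopfAction k T A where
  act := ρ
  act_mul := by
    intro h
    change ∀ a b, ρ h (a * b) = mulMap ρ a b (Coalgebra.comul (R := k) h)
    have hh : h ∈ Algebra.adjoin k s := by rw [hgen]; trivial
    induction hh using Algebra.adjoin_induction with
    | mem h hh => exact hm h hh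
    | algebraMap c =>
      intro a b
      rw [Bialgebra.comul_algebraMap, Algebra.TensorProduct.algebraMap_apply, mulMap_tmul]
      simp
    | add u v _ _ hu hv => intro a b; simp [hu, hv]
    | mul u v _ _ hu hv =>
      intro a b
      rw [map_mul ρ, Module.End.mul_apply, hv, mulMap_comul ρ hu, Bialgebra.comul_mul]
  act_one := by
    intro h
    have hh : h ∈ Algebra.adjoin k s := by rw [hgen]; trivial
    induction hh using Algebra.adjoin_induction with
    | mem h hh => exact h1 h hh
    | algebraMap c => simp
    | add u v _ _ hu hv => simp [hu, hv, add_smul]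
    | mul u v _ _ hu hv => simp [hu, hv, smul_smul, mul_comm]

end action

theorem exists_min_image_of {k : Type} [Field k] {n : ℕ} (c : Fin n × Fin n × Fin n → k)
    (hex : ∃ a, c a ≠ 0) : ∃ a₀, c a₀ ≠ 0 ∧ ∀ a, c a ≠ 0 →
      (a₀.1 : ℕ) + (a₀.2.1 : ℕ) ≤ (a.1 : ℕ) + (a.2.1 : ℕ) := by
  classical
  obtain ⟨a, ha⟩ := hex
  obtain ⟨b, hb, hmin⟩ := Finset.exists_min_image (Finset.univ.filter fun a => c a ≠ 0)
    (fun a => (a.1 : ℕ) + (a.2.1 : ℕ)) ⟨a, by simpa using ha⟩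
  exact ⟨b, by simpa using hb, fun a ha => hmin a (by simpa using ha)⟩

section conv
variable {k T : Type} [Field k] [Ring T] [HopfAlgebra k T]

noncomputable def contr (φ : T →ₗ[k] k) : T ⊗[k] T →ₗ[k] T :=
  (TensorProduct.lid k T).toLinearMap ∘ₗ LinearMap.rTensor T φ

theorem contr_tmul (φ : T →ₗ[k] k) (a b : T) : contr φ (a ⊗ₜ b) = φ a • b := by
  simp [contr]

noncomputable def lconv (φ : T →ₗ[k] k) : T →ₗ[k] T := contr φ ∘ₗ Coalgebra.comul (R := k)

theorem lconv_apply (φ : T →ₗ[k] k) (h : T) :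
    lconv φ h = contr φ (Coalgebra.comul (R := k) h) := rfl

theorem lconv_mem (I : HopfIdeal k T) {φ : T →ₗ[k] k} (hφ : ∀ h ∈ I.carrier, φ h = 0)
    {h : T} (hh : h ∈ I.carrier) : lconv φ h ∈ I.carrier := by
  have hle : (LinearMap.range (TensorProduct.map I.carrier.subtype (LinearMap.id (M := T))) ⊔
       LinearMap.range (TensorProduct.map (LinearMap.id (M := T)) I.carrier.subtype))
       ≤ I.carrier.comap (contr φ) := by
    refine sup_le ?_ ?_
    · rintro _ ⟨z, rfl⟩
      rw [Submodule.mem_comap]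
      induction z using TensorProduct.induction_on with
      | zero => simp
      | add z z' h h' => rw [map_add, map_add]; exact Submodule.add_mem _ h h'
      | tmul x y => simp [contr_tmul, hφ x x.2]
    · rintro _ ⟨z, rfl⟩
      rw [Submodule.mem_comap]
      induction z using TensorProduct.induction_on with
      | zero => simp
      | add z z' h h' => rw [map_add, map_add]; exact Submodule.add_mem _ h h'
      | tmul x y =>
        rw [TensorProduct.map_tmul, contr_tmul]
        exact Submodule.smul_mem _ _ y.2
  exact hle (I.comul_mem h hh)

theorem lconv_mul {φ α β γ δ : T →ₗ[k] k} (h : ∀ a b, φ (a * b) = α a * β b + γ a * δ b) (a b : T) :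
    lconv φ (a * b) = lconv α a * lconv β b + lconv γ a * lconv δ b := by
  simp only [lconv_apply, Bialgebra.comul_mul]
  generalize Coalgebra.comul (R := k) a = A
  generalize Coalgebra.comul (R := k) b = B
  induction A using TensorProduct.induction_on with
  | zero => simp
  | add A A' hA hA' => simp only [add_mul, map_add, hA, hA']; abel
  | tmul a a' =>
    induction B using TensorProduct.induction_on with
    | zero => simp
    | add A A' hA hA' => simp only [mul_add, map_add, hA, hA']; abel
    | tmul b b' =>
      simp only [Algebra.TensorProduct.tmul_mul_tmul, contr_tmul, h, add_smul, smul_mul_smul_comm]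

theorem avg_mem {V : Type} [AddCommGroup V] [Module k V] [CharZero k] (W : Submodule k V)
    (τ : V →ₗ[k] V) (hτ : ∀ v ∈ W, τ v ∈ W) {n : ℕ} (hn : 0 < n) (v : Fin n → V) (μ : Fin n → k)
    (hv : ∀ l, τ (v l) = μ l • v l) (hμ : Function.Injective μ) (hμn : ∀ l, μ l ^ n = 1)
    (hsum : ∑ l, v l ∈ W) (l₀ : Fin n) : v l₀ ∈ W := by
  have hμ0 : ∀ l, μ l ≠ 0 := by
    intro l h
    have := hμn l
    rw [h, zero_pow hn.ne'] at this
    exact zero_ne_one this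
  have hpow : ∀ (s : ℕ) l, (τ ^ s) (v l) = μ l ^ s • v l := by
    intro s l
    induction s with
    | zero => simp
    | succ s ih => rw [pow_succ', Module.End.mul_apply, ih, map_smul, hv, smul_smul, pow_succ]
  have hW : ∀ s : ℕ, ∀ v ∈ W, (τ ^ s) v ∈ W := by
    intro s
    induction s with
    | zero => intro v h; simpa using h
    | succ s ih => intro v h; rw [pow_succ', Module.End.mul_apply]; exact hτ _ (ih v h)
  have h1 : ∑ s ∈ Finset.range n, ((μ l₀)⁻¹ ^ s) • (τ ^ s) (∑ l, v l) ∈ W :=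
    Submodule.sum_mem _ fun s _ => Submodule.smul_mem _ _ (hW s _ hsum)
  have h2 : ∑ s ∈ Finset.range n, ((μ l₀)⁻¹ ^ s) • (τ ^ s) (∑ l, v l) = (n : k) • v l₀ := by
    simp only [map_sum, hpow, Finset.smul_sum, smul_smul, ← mul_pow]
    rw [Finset.sum_comm]
    simp only [← Finset.sum_smul]
    rw [Finset.sum_eq_single l₀]
    · rw [inv_mul_cancel₀ (hμ0 _)]; simp
    · intro l _ hl
      have hr : (μ l₀)⁻¹ * μ l ≠ 1 := by
        intro h
        exact hl (hμ (by rw [inv_mul_eq_one₀ (hμ0 _)] at h; exact h.symm))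
      have := geom_sum_mul ((μ l₀)⁻¹ * μ l) n
      rw [mul_pow, inv_pow, hμn, hμn, inv_one, one_mul, sub_self] at this
      rcases mul_eq_zero.mp this with h | h
      · rw [h, zero_smul]
      · exact absurd (sub_eq_zero.mp h) hr
    · simp
  rw [h2] at h1
  have := W.smul_mem ((n : k)⁻¹) h1
  rwa [smul_smul, inv_mul_cancel₀ (by exact_mod_cast hn.ne'), one_smul] at this

end conv

section faithful
variable {k T : Type} [Field k] [CharZero k] [Ring T] [HopfAlgebra k T]

/-- abstract form: an ideal killed by two characters and a skew derivation is zero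
once it does not contain the top power of `x₂` -/
theorem ideal_bot {n : ℕ} (hn : 2 ≤ n) {ζ : k} (hζ : IsPrimitiveRoot ζ n) {g x y : T}
    (hb : BookRel n 1 ζ g x y)
    (hg : IsGrouplike k g)
    (hx : Coalgebra.comul (R := k) x = (1 : T) ⊗ₜ[k] x + x ⊗ₜ[k] g)
    (hy : Coalgebra.comul (R := k) y = g ⊗ₜ[k] y + y ⊗ₜ[k] (1 : T))
    (hgen : Algebra.adjoin k {g, x, y} = ⊤)
    (I : HopfIdeal k T)
    (χ₁ χ₂ δ : T →ₗ[k] k)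
    (hχ₁ : ∀ h ∈ I.carrier, χ₁ h = 0) (hδ : ∀ h ∈ I.carrier, δ h = 0)
    (m₁ : ∀ a b, χ₁ (a * b) = χ₁ a * χ₁ b)
    (mδ : ∀ a b, δ (a * b) = χ₂ a * δ b + δ a * χ₁ b)
    (m₂ : ∀ a b, χ₂ (a * b) = χ₂ a * χ₂ b)
    (o₁ : χ₁ 1 = 1) (o₂ : χ₂ 1 = 1) (g₁ : χ₁ g = ζ) (x₁ : χ₁ x = 0)
    (y₁ : χ₁ y = 0) (x₂ : χ₂ x = 0)
    (δ1 : δ 1 = 0) (δg : δ g = 0) (δx : δ x = ζ - 1) (δy : δ y = 0)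
    (htop : y ^ (n - 1) ∉ I.carrier) : I.carrier = ⊥ := by
  have h0 : ζ ≠ 0 := hζ.ne_zero (by omega)
  have M₁ : ∀ a b, lconv χ₁ (a * b) = lconv χ₁ a * lconv χ₁ b := by
    intro a b
    have := lconv_mul (φ := χ₁) (α := χ₁) (β := χ₁) (γ := 0) (δ := 0) (by simpa using m₁) a b
    rw [this]; simp [lconv, contr]
  have M₂ : ∀ a b, lconv χ₂ (a * b) = lconv χ₂ a * lconv χ₂ b := by
    intro a b
    have := lconv_mul (φ := χ₂) (α := χ₂) (β := χ₂) (γ := 0) (δ := 0) (by simpa using m₂) a b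
    rw [this]; simp [lconv, contr]
  have Mδ := lconv_mul mδ
  have one₁ : lconv χ₁ (1 : T) = 1 := by
    rw [lconv_apply, Bialgebra.comul_one, Algebra.TensorProduct.one_def, contr_tmul, o₁, one_smul]
  have G₁ : lconv χ₁ g = ζ • g := by rw [lconv_apply, hg.2, contr_tmul, g₁]
  have X₁ : lconv χ₁ x = x := by
    rw [lconv_apply, hx, map_add, contr_tmul, contr_tmul, o₁, x₁]; simp
  have Y₁ : lconv χ₁ y = ζ • y := by
    rw [lconv_apply, hy, map_add, contr_tmul, contr_tmul, g₁, y₁]; simp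
  have X₂ : lconv χ₂ x = x := by
    rw [lconv_apply, hx, map_add, contr_tmul, contr_tmul, o₂, x₂]; simp
  have Xδ : lconv δ x = (ζ - 1) • g := by
    rw [lconv_apply, hx, map_add, contr_tmul, contr_tmul, δ1, δx]; simp
  have Yδ : lconv δ y = 0 := by
    rw [lconv_apply, hy, map_add, contr_tmul, contr_tmul, δg, δy]; simp
  have oneδ : lconv δ (1 : T) = 0 := by
    rw [lconv_apply, Bialgebra.comul_one, Algebra.TensorProduct.one_def, contr_tmul, δ1, zero_smul]
  have P₁ : ∀ (a : T) (i : ℕ), lconv χ₁ (a ^ i) = lconv χ₁ a ^ i := by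
    intro a i
    induction i with
    | zero => simpa using one₁
    | succ i ih => rw [pow_succ, M₁, ih, pow_succ]
  have YPδ : ∀ j : ℕ, lconv δ (y ^ j) = 0 := by
    intro j
    induction j with
    | zero => simpa using oneδ
    | succ j ih => rw [pow_succ, Mδ, ih, Yδ]; simp
  have XPδ : ∀ m : ℕ, lconv δ (x ^ (m + 1)) = (ζ ^ (m + 1) - 1) • (x ^ m * g) := by
    intro m
    induction m with
    | zero => simpa using Xδ
    | succ m ih =>
      rw [pow_succ', Mδ, ih, X₂, Xδ, P₁, X₁, smul_mul_assoc, skew_pow hb.gx, mul_smul_comm,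
        ← mul_assoc, ← pow_succ', smul_smul, ← add_smul]
      congr 1; ring
  have gu : g * g ^ (n - 1) = 1 := by
    rw [← pow_succ', Nat.sub_add_cancel (by omega)]; exact hb.gn
  -- descend
  have desc : ∀ m, m < n → x ^ m * y ^ (n - 1) ∈ I.carrier → y ^ (n - 1) ∈ I.carrier := by
    intro m
    induction m with
    | zero => intro _ h; simpa using h
    | succ m ih =>
      intro hm h
      apply ih (by omega)
      have h1 := lconv_mem I hδ h
      rw [Mδ, YPδ, XPδ, P₁, Y₁, mul_zero, zero_add, smul_pow, smul_mul_assoc, mul_smul_comm,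
        mul_assoc, skew_pow hb.gy, mul_smul_comm, smul_smul, smul_smul] at h1
      have hc : (ζ ^ (m + 1) - 1) * (ζ ^ (n - 1)) * (ζ ^ 1) ^ (n - 1) ≠ 0 := by
        refine mul_ne_zero (mul_ne_zero ?_ (pow_ne_zero _ h0)) (pow_ne_zero _ (pow_ne_zero _ h0))
        rw [sub_ne_zero]
        exact hζ.pow_ne_one_of_pos_of_lt (by omega) hm
      have h2 := (Submodule.smul_mem_iff _ hc).mp h1
      have h3 := I.mul_mem_right (g ^ (n - 1)) h2
      rwa [mul_assoc, mul_assoc, gu, mul_one] at h3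
  -- suppose nonzero
  by_contra hne
  obtain ⟨h, hI, hh0⟩ := Submodule.exists_mem_ne_zero_of_ne_bot hne
  have hspan := hb.adjoin_le (k := k) (by omega) (r := h) (by rw [hgen]; trivial)
  rw [Submodule.mem_span_range_iff_exists_fun] at hspan
  obtain ⟨c, hc⟩ := hspan
  have hex : ∃ a, c a ≠ 0 := by
    by_contra! hcon
    apply hh0
    rw [← hc]; simp [hcon]
  obtain ⟨a₀, ha₀, hmin⟩ := exists_min_image_of (n := n) c hex
  obtain ⟨i₀, j₀, l₀⟩ := a₀
  have h1 : x ^ (n - 1 - i₀) * y ^ (n - 1 - j₀) * h ∈ I.carrier := I.mul_mem_left _ hI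
  have hmon : ∀ i j l : ℕ, x ^ (n - 1 - i₀) * y ^ (n - 1 - j₀) * (x ^ i * y ^ j * g ^ l)
      = x ^ (n - 1 - i₀ + i) * y ^ (n - 1 - j₀ + j) * g ^ l := by
    intro i j l
    have cc : y ^ (n - 1 - (j₀ : ℕ)) * x ^ i = x ^ i * y ^ (n - 1 - (j₀ : ℕ)) :=
      ((Commute.pow_pow hb.xy i (n - 1 - j₀)).symm).eq
    rw [pow_add, pow_add]
    calc _ = x ^ (n - 1 - (i₀ : ℕ)) * (y ^ (n - 1 - (j₀ : ℕ)) * x ^ i) * y ^ j * g ^ l := by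
          simp only [mul_assoc]
      _ = _ := by rw [cc]; simp only [mul_assoc]
  have h2 : x ^ (n - 1 - i₀) * y ^ (n - 1 - j₀) * h
      = ∑ l, c (i₀, j₀, l) • (x ^ (n - 1) * y ^ (n - 1) * g ^ (l : ℕ)) := by
    rw [← hc, Finset.mul_sum, Fintype.sum_prod_type, Finset.sum_eq_single i₀]
    · rw [Fintype.sum_prod_type, Finset.sum_eq_single j₀]
      · refine Finset.sum_congr rfl fun l _ => ?_
        rw [mul_smul_comm, bookMon, hmon]
        simp only
        rw [Nat.sub_add_cancel (by omega), Nat.sub_add_cancel (by omega)]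
      · intro j _ hj
        refine Finset.sum_eq_zero fun l _ => ?_
        by_cases hz : c (i₀, j, l) = 0
        · rw [hz]; simp
        · have := hmin _ hz
          have hj' : (j : ℕ) ≠ j₀ := fun e => hj (Fin.ext e)
          simp only at this
          rw [mul_smul_comm, bookMon, hmon, pow_eq_zero_of_le (m := n) (n := n - 1 - j₀ + j) _ hb.yn]
          · simp
          · omega
      · simp
    · intro i _ hi
      refine Finset.sum_eq_zero fun jl _ => ?_
      obtain ⟨j, l⟩ := jl
      by_cases hz : c (i, j, l) = 0
      · rw [hz]; simp
      · have := hmin _ hz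
        have hi' : (i : ℕ) ≠ i₀ := fun e => hi (Fin.ext e)
        simp only at this
        rw [mul_smul_comm, bookMon, hmon]
        by_cases hlt : (i₀ : ℕ) < i
        · rw [pow_eq_zero_of_le (m := n) (n := n - 1 - i₀ + i) _ hb.xn]
          · simp
          · omega
        · rw [pow_eq_zero_of_le (m := n) (n := n - 1 - j₀ + j) _ hb.yn]
          · simp
          · omega
    · simp
  rw [h2] at h1
  have h3 := avg_mem I.carrier (lconv χ₁) (fun v hv => lconv_mem I hχ₁ hv) (by omega)
    (fun l : Fin n => c (i₀, j₀, l) • (x ^ (n - 1) * y ^ (n - 1) * g ^ (l : ℕ)))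
    (fun l => ζ ^ (n - 1) * ζ ^ (l : ℕ))
    (by
      intro l
      rw [map_smul, M₁, M₁, P₁, P₁, P₁, X₁, Y₁, G₁, smul_pow, smul_pow]
      simp only [mul_smul_comm, smul_mul_assoc, smul_smul]
      congr 1; ring)
    (by
      intro l l' hll
      have := mul_left_cancel₀ (pow_ne_zero _ h0) hll
      exact Fin.ext (hζ.pow_inj l.2 l'.2 this))
    (by
      intro l
      rw [mul_pow, ← pow_mul, ← pow_mul, mul_comm _ n, mul_comm _ n, pow_mul, pow_mul,
        hζ.pow_eq_one]; simp)
    h1 l₀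
  have h4 := I.carrier.smul_mem (c (i₀, j₀, l₀))⁻¹ h3
  rw [smul_smul, inv_mul_cancel₀ ha₀, one_smul] at h4
  have h5 := I.mul_mem_right (g ^ (n - l₀)) h4
  rw [mul_assoc, ← pow_add, Nat.add_sub_cancel' l₀.2.le, hb.gn, mul_one] at h5
  exact htop (desc (n - 1) (by omega) h5)

end faithful

section exist
variable {k T : Type} [Field k] [CharZero k] [Ring T] [HopfAlgebra k T]

theorem exists_witness {n : ℕ} (hn : 2 ≤ n) {ζ : k} (hζ : IsPrimitiveRoot ζ n) {g x y : T}
    (hb : BookRel n 1 ζ g x y)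
    (hg : IsGrouplike k g)
    (hx : Coalgebra.comul (R := k) x = (1 : T) ⊗ₜ[k] x + x ⊗ₜ[k] g)
    (hy : Coalgebra.comul (R := k) y = g ⊗ₜ[k] y + y ⊗ₜ[k] (1 : T))
    (hgen : Algebra.adjoin k {g, x, y} = ⊤)
    (hdim : Module.finrank k T = n ^ 3) : GaloisTheoretical k T := by
  have h0 : ζ ≠ 0 := hζ.ne_zero (by omega)
  have hr1 : ζ ^ (1 : ℤ) = ζ := zpow_one ζ
  have hr2 : ζ ^ ((n : ℤ) + 1) = ζ := by rw [zpow_add₀ h0]; simp [hζ.pow_eq_one]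
  obtain ⟨ρ, ρg, ρx, ρy⟩ := hb.exists_lift (by omega) hgen hdim (laurent_rel hn hζ)
  have εg : Coalgebra.counit (R := k) g = 1 := counit_of_grouplike hg
  have εx : Coalgebra.counit (R := k) x = 0 := counit_of_skew₁ (by simp) εg hx
  have εy : Coalgebra.counit (R := k) y = 0 := counit_of_skew₁ εg (by simp) hy
  have dmul1 : ∀ (r : ℤ) (a b : LaurentSeries k),
      dOp ζ r (a * b) = a * dOp ζ r b + dOp ζ r a * sigL ζ b := by
    intro r a b
    simp only [dOp_apply, sigL_mul h0]; ring
  have dmul2 : ∀ (r : ℤ) (a b : LaurentSeries k),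
      dOp ζ r (a * b) = sigL ζ a * dOp ζ r b + dOp ζ r a * b := by
    intro r a b
    simp only [dOp_apply, sigL_mul h0]; ring
  have done : ∀ r : ℤ, dOp ζ r 1 = 0 := by
    intro r
    rw [dOp_apply, sigL_one, sub_self, mul_zero]
  let A : HopfAction k T (LaurentSeries k) := mkAction ρ hgen
    (by
      rintro h (rfl | rfl | rfl) a b
      · rw [hg.2, mulMap_tmul, ρg, sigL_mul h0]
      · rw [hx, map_add, mulMap_tmul, mulMap_tmul, ρg, ρx, map_one, dmul1]; rfl
      · rw [hy, map_add, mulMap_tmul, mulMap_tmul, ρg, ρy, map_one, dmul2]; rfl)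
    (by
      rintro h (rfl | rfl | rfl)
      · rw [ρg, εg, sigL_one, one_smul]
      · rw [ρx, εx, done, zero_smul]
      · rw [ρy, εy, done, zero_smul])
  refine ⟨@GTWitness.mk k T _ _ _ (LaurentSeries k) _ lsAlg A ?_⟩
  intro I hI
  have hI' : ∀ h ∈ I.carrier, ρ h = 0 := hI
  have key : ∀ h : T, ∃ a b d : k, ∀ f : LaurentSeries k, (∀ m < 1, f.coeff m = 0) →
      (∀ m < 1, (ρ h f).coeff m = 0) ∧ (ρ h f).coeff 1 = a * f.coeff 1 ∧
      (ρ h f).coeff 2 = b * f.coeff 2 + d * f.coeff 1 := by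
    intro h
    have hh : h ∈ Algebra.adjoin k {g, x, y} := by rw [hgen]; trivial
    induction hh using Algebra.adjoin_induction with
    | mem h hh =>
      rcases hh with rfl | rfl | rfl
      · refine ⟨ζ, ζ ^ (2 : ℤ), 0, fun f hf => ⟨fun m hm => ?_, ?_, ?_⟩⟩
        · rw [ρg, sigL_coeff, hf m hm, mul_zero]
        · rw [ρg, sigL_coeff, zpow_one]
        · rw [ρg, sigL_coeff, zero_mul, add_zero]
      · refine ⟨0, 0, ζ - 1, fun f hf => ⟨fun m hm => ?_, ?_, ?_⟩⟩
        · rw [ρx, dOp_coeff h0 hr1, hf _ (by omega), mul_zero]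
        · rw [ρx, dOp_coeff h0 hr1, hf _ (by omega), mul_zero, zero_mul]
        · rw [ρx, dOp_coeff h0 hr1, zero_mul, zero_add, show (2 : ℤ) - 1 = 1 by norm_num, zpow_one]
      · refine ⟨0, 0, 0, fun f hf => ⟨fun m hm => ?_, ?_, ?_⟩⟩
        · rw [ρy, dOp_coeff h0 hr2, hf _ (by omega), mul_zero]
        · rw [ρy, dOp_coeff h0 hr2, hf _ (by omega), mul_zero, zero_mul]
        · rw [ρy, dOp_coeff h0 hr2, hf _ (by omega)]; simp
    | algebraMap c =>
      refine ⟨c, c, 0, fun f hf => ⟨fun m hm => ?_, ?_, ?_⟩⟩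
      · simp [hf m hm]
      · simp
      · simp
    | add u v _ _ hu hv =>
      obtain ⟨a, b, d, hu⟩ := hu
      obtain ⟨a', b', d', hv⟩ := hv
      refine ⟨a + a', b + b', d + d', fun f hf => ?_⟩
      obtain ⟨u1, u2, u3⟩ := hu f hf
      obtain ⟨v1, v2, v3⟩ := hv f hf
      rw [map_add, LinearMap.add_apply]
      simp only [HahnSeries.coeff_add]
      refine ⟨fun m hm => ?_, ?_, ?_⟩
      · rw [u1 m hm, v1 m hm, add_zero]
      · rw [u2, v2]; ring
      · rw [u3, v3]; ring
    | mul u v _ _ hu hv =>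
      obtain ⟨a, b, d, hu⟩ := hu
      obtain ⟨a', b', d', hv⟩ := hv
      refine ⟨a * a', b * b', b * d' + d * a', fun f hf => ?_⟩
      obtain ⟨v1, v2, v3⟩ := hv f hf
      obtain ⟨u1, u2, u3⟩ := hu _ v1
      rw [map_mul ρ, Module.End.mul_apply]
      refine ⟨u1, ?_, ?_⟩
      · rw [u2, v2]; ring
      · rw [u3, v2, v3]; ring
  let e₁ : LaurentSeries k := HahnSeries.single 1 1
  let e₂ : LaurentSeries k := HahnSeries.single 2 1
  have e11 : e₁.coeff 1 = 1 := HahnSeries.coeff_single_same _ _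
  have e12 : e₁.coeff 2 = 0 := HahnSeries.coeff_single_of_ne (by norm_num)
  have e21 : e₂.coeff 1 = 0 := HahnSeries.coeff_single_of_ne (by norm_num)
  have e22 : e₂.coeff 2 = 1 := HahnSeries.coeff_single_same _ _
  have e1m : ∀ m < 1, e₁.coeff m = 0 := fun m hm => HahnSeries.coeff_single_of_ne (by omega)
  have e2m : ∀ m < 1, e₂.coeff m = 0 := fun m hm => HahnSeries.coeff_single_of_ne (by omega)
  let F : LaurentSeries k → ℤ → (T →ₗ[k] k) := fun e m =>
    { toFun := fun h => (ρ h e).coeff m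
      map_add' := fun a b => by simp
      map_smul' := fun c a => by simp }
  have Fdef : ∀ e m h, F e m h = (ρ h e).coeff m := fun _ _ _ => rfl
  have key2 : ∀ h : T, ∀ f : LaurentSeries k, (∀ m < 1, f.coeff m = 0) →
      (∀ m < 1, (ρ h f).coeff m = 0) ∧ (ρ h f).coeff 1 = F e₁ 1 h * f.coeff 1 ∧
      (ρ h f).coeff 2 = F e₂ 2 h * f.coeff 2 + F e₁ 2 h * f.coeff 1 := by
    intro h
    obtain ⟨a, b, d, hk⟩ := key h
    obtain ⟨-, p2, p3⟩ := hk e₁ e1m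
    obtain ⟨-, q2, q3⟩ := hk e₂ e2m
    rw [e11, mul_one] at p2
    rw [e11, e12, mul_zero, zero_add, mul_one] at p3
    rw [e21, e22, mul_zero, add_zero, mul_one] at q3
    intro f hf
    rw [Fdef, Fdef, Fdef, p2, p3, q3]
    exact hk f hf
  refine ideal_bot hn hζ hb hg hx hy hgen I (F e₁ 1) (F e₂ 2) (F e₁ 2)
    ?_ ?_ ?_ ?_ ?_ ?_ ?_ ?_ ?_ ?_ ?_ ?_ ?_ ?_ ?_ ?_
  · intro h hh; rw [Fdef, hI' h hh]; rfl
  · intro h hh; rw [Fdef, hI' h hh]; rfl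
  · intro a b
    rw [Fdef, map_mul, Module.End.mul_apply, (key2 a _ (key2 b e₁ e1m).1).2.1]; rfl
  · intro a b
    rw [Fdef, map_mul, Module.End.mul_apply, (key2 a _ (key2 b e₁ e1m).1).2.2]; rfl
  · intro a b
    rw [Fdef, map_mul, Module.End.mul_apply, (key2 a _ (key2 b e₂ e2m).1).2.2,
      (key2 b e₂ e2m).2.1, e21]
    simp [Fdef]
  · rw [Fdef, map_one]; exact e11
  · rw [Fdef, map_one]; exact e22
  · rw [Fdef, ρg, sigL_coeff, e11, zpow_one, mul_one]
  · rw [Fdef, ρx, dOp_coeff h0 hr1, e1m _ (by omega), mul_zero]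
  · rw [Fdef, ρy, dOp_coeff h0 hr2, e1m _ (by omega), mul_zero]
  · rw [Fdef, ρx, dOp_coeff h0 hr1, show (2 : ℤ) - 1 = 1 by norm_num, e21, mul_zero]
  · rw [Fdef, map_one]; exact e12
  · rw [Fdef, ρg, sigL_coeff, e12, mul_zero]
  · rw [Fdef, ρx, dOp_coeff h0 hr1, show (2 : ℤ) - 1 = 1 by norm_num, e11, zpow_one, mul_one]
  · rw [Fdef, ρy, dOp_coeff h0 hr2, e1m _ (by omega), mul_zero]
  · intro hmem
    have h1 := hI' _ hmem
    rw [map_pow, ρy] at h1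
    have h2 := dOp_pow_coeff h0 hr2 (n - 1) e₁ (1 + ((n - 1 : ℕ) : ℤ) * (n + 1))
    rw [h1, add_sub_cancel_right, e11, mul_one] at h2
    have h3 : (0 : k) = _ := h2
    refine absurd h3.symm (Finset.prod_ne_zero_iff.mpr fun s hs => ?_)
    rw [Finset.mem_range] at hs
    rw [sub_ne_zero]
    intro h4
    rw [hζ.zpow_eq_one_iff_dvd] at h4
    have h5 : (n : ℤ) ∣ (1 + s : ℤ) := by
      have : (1 + s : ℤ) = n * n - (1 + ((n - 1 : ℕ) : ℤ) * (n + 1) - 1 - s) := by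
        rw [Nat.cast_sub (by omega)]; push_cast; ring
      rw [this]
      exact dvd_sub (dvd_mul_right _ _) h4
    have := Int.le_of_dvd (by omega) h5
    omega

end exist

/-- **Statement 18.** A book algebra `h(ζ, p)` (presented by a grouplike `g`, a `(1,g)`-skew
primitive `x₁` and a `(g^p,1)`-skew primitive `x₂` with `gⁿ = 1`, `x₁ⁿ = x₂ⁿ = 0`,
`g x₁ = ζ x₁ g`, `g x₂ = ζ^p x₂ g`, `x₁ x₂ = x₂ x₁`, where `p < n` are coprime, `n ≥ 2` and
`ζ` is a primitive `n`-th root of unity; it has dimension `n³`) is Galois-theoretical if and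
only if `p = 1`.  In that case, any inner faithful `h(ζ,1)`-module field `L` is a cyclic
degree-`n` Galois extension of its subfield of invariants with Galois group `ℤ_n`. -/
theorem book_algebra_galoisTheoretical_iff
    (k : Type) [Field k] [IsAlgClosed k] [CharZero k]
    (n p : ℕ) (hn : 2 ≤ n) (hp : 0 < p) (hpn : p < n) (hcop : Nat.Coprime p n)
    (ζ : k) (hζ : IsPrimitiveRoot ζ n)
    (T : Type) [Ring T] [HopfAlgebra k T]
    (g x₁ x₂ : T)
    (hg : IsGrouplike k g)
    (hx₁ : Coalgebra.comul (R := k) x₁ = (1 : T) ⊗ₜ[k] x₁ + x₁ ⊗ₜ[k] g)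
    (hx₂ : Coalgebra.comul (R := k) x₂ = (g ^ p) ⊗ₜ[k] x₂ + x₂ ⊗ₜ[k] (1 : T))
    (hgn : g ^ n = 1) (hx₁n : x₁ ^ n = 0) (hx₂n : x₂ ^ n = 0)
    (hgx₁ : g * x₁ = ζ • (x₁ * g)) (hgx₂ : g * x₂ = ζ ^ p • (x₂ * g))
    (hx₁x₂ : x₁ * x₂ = x₂ * x₁)
    (hgen : Algebra.adjoin k {g, x₁, x₂} = ⊤)
    (hdim : Module.finrank k T = n ^ 3) :
    (GaloisTheoretical k T ↔ p = 1) ∧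
    (p = 1 → ∀ (L : Type) [Field L] [Algebra k L] (ha : HopfAction k T L),
      InnerFaithful k ha.act.toLinearMap →
      ∃ F : IntermediateField k L,
        (F : Set L) = ha.invariants ∧
        IsGalois F L ∧ Module.finrank (↥F) L = n ∧
        Nonempty ((L ≃ₐ[F] L) ≃* Multiplicative (ZMod n))) := by
  have hb : BookRel n p ζ g x₁ x₂ := ⟨hgn, hx₁n, hx₂n, hgx₁, hgx₂, hx₁x₂⟩
  have hli := hb.linInd (by omega) hgen hdim
  have hx₁0 : x₁ ≠ 0 := by
    have := hli.ne_zero (⟨1, by omega⟩, ⟨0, by omega⟩, ⟨0, by omega⟩)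
    simpa [bookMon] using this
  have hx₂0 : x₂ ≠ 0 := by
    have := hli.ne_zero (⟨0, by omega⟩, ⟨1, by omega⟩, ⟨0, by omega⟩)
    simpa [bookMon] using this
  have εg : Coalgebra.counit (R := k) g = 1 := counit_of_grouplike hg
  have εx : Coalgebra.counit (R := k) x₁ = 0 := counit_of_skew₁ (by simp) εg hx₁
  have εy : Coalgebra.counit (R := k) x₂ = 0 :=
    counit_of_skew₁ (by rw [Bialgebra.counit_pow, εg, one_pow]) (by simp) hx₂
  have gu : g * g ^ (n - 1) = 1 := by
    rw [← pow_succ', Nat.sub_add_cancel (by omega)]; exact hgn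
  refine ⟨⟨?_, ?_⟩, ?_⟩
  · rintro ⟨w⟩
    letI := w.fieldL
    letI := w.algL
    exact p_eq_one w.action hn hp hpn hζ hg hx₁ hx₂ hgn hgx₁ hgx₂ hx₁x₂
      (act_ne_zero w.action.act w.faithful hx₁ εx gu hx₁0)
      (act_ne_zero w.action.act w.faithful hx₂ εy (one_mul 1) hx₂0)
  · intro h1
    subst h1
    rw [pow_one] at hx₂
    exact exists_witness hn hζ hb hg hx₁ hx₂ hgen hdim
  · intro h1 L _ _ ha hf
    subst h1
    rw [pow_one] at hx₂
    exact book_galois ha hn hζ hg hx₁ hx₂ hgn hgx₁ hgen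
      (act_ne_zero ha.act hf hx₁ εx gu hx₁0)
end
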